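/- arXiv:2103.14309 — 3 statements merged into one kernel-verified Lean document; each statement's English description precedes it below -/
import Mathlib

section
/- For a generic map f in C_λ(I) (i.e., for every f in some residual subset of C_λ(I)) and for every integer k ≥ 1, the set Fix(f,k) = {x ∈ [0,1] : f^k(x) = x} is a Cantor set. -/
open MeasureTheory Set Metric Filter Topology

noncomputable section

/-- Lebesgue measure on the unit interval `[0,1]`, viewed as a measure on the subtype. -/
def lebI : Measure unitInterval := (volume : Measure ℝ).comap Subtype.val

/-- A continuous self-map of `[0,1]` preserves Lebesgue measure. -/
def MeasPres (f : C(unitInterval, unitInterval)) : Prop :=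
  ∀ A : Set unitInterval, MeasurableSet A → lebI (f ⁻¹' A) = lebI A

/-- The space `C_λ(I)` of continuous Lebesgue-measure-preserving maps of `[0,1]`. -/
def CLam : Set C(unitInterval, unitInterval) := {f | MeasPres f}

/-- `Fix(f,k) = {x : f^k x = x}`. -/
def FixSet {X : Type*} (f : X → X) (k : ℕ) : Set X := {x | f^[k] x = x}

/-- A Cantor set: nonempty, compact, perfect and totally disconnected. -/
def IsCantorSet {X : Type*} [TopologicalSpace X] (C : Set X) : Prop :=
  C.Nonempty ∧ IsCompact C ∧ Perfect C ∧ IsTotallyDisconnected C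

theorem lebI_apply (S : Set unitInterval) : lebI S = volume ((↑) '' S : Set ℝ) :=
  (MeasurableEmbedding.subtype_coe measurableSet_Icc).comap_apply _ _

theorem lebI_Icc (a b : unitInterval) : lebI (Icc a b) = ENNReal.ofReal (b - a) := by
  rw [lebI_apply]
  have : ((↑) '' Icc a b : Set ℝ) = Icc (a : ℝ) b := by
    ext x
    constructor
    · rintro ⟨y, hy, rfl⟩
      exact hy
    · intro hx
      exact ⟨⟨x, a.2.1.trans hx.1, hx.2.trans b.2.2⟩, hx, rfl⟩
  rw [this, Real.volume_Icc]

instance : IsFiniteMeasure lebI := ⟨by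
  have h := lebI_Icc 0 1
  rw [show Icc (0 : unitInterval) 1 = univ from Icc_bot_top] at h
  simp [h]⟩

theorem MeasPres.measurePreserving {f : C(unitInterval, unitInterval)} (hf : MeasPres f) :
    MeasurePreserving f lebI lebI :=
  ⟨f.continuous.measurable, by
    ext A hA
    rw [Measure.map_apply f.continuous.measurable hA, hf A hA]⟩

theorem MeasPres.comp {f g : C(unitInterval, unitInterval)} (hf : MeasPres f) (hg : MeasPres g) :
    MeasPres (f.comp g) := fun A hA => by
  rw [ContinuousMap.coe_comp, preimage_comp, hg _ (f.continuous.measurable hA), hf A hA]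

theorem measPres_of_Iic {f : C(unitInterval, unitInterval)}
    (hf : ∀ t, lebI (f ⁻¹' Iic t) = lebI (Iic t)) : MeasPres f := by
  have h : lebI.map f = lebI := Measure.ext_of_Iic _ _ fun t => by
    rw [Measure.map_apply f.continuous.measurable measurableSet_Iic, hf]
  intro A hA
  rw [← Measure.map_apply f.continuous.measurable hA, h]

/-- The piecewise affine map which folds `[a, b]` three times over itself and is the identity
elsewhere. -/
def zigzag (a b x : ℝ) : ℝ :=
  x - max a (min x b) + max (min (3 * max a (min x b) - 2 * a)
    (2 * (a + b) - 3 * max a (min x b))) (3 * max a (min x b) - 2 * b)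

theorem continuous_zigzag (a b : ℝ) : Continuous (zigzag a b) := by
  unfold zigzag
  fun_prop

theorem zigzag_of_le {a b x : ℝ} (hab : a < b) (hx : x ≤ a) : zigzag a b x = x := by
  rw [zigzag, min_eq_left (hx.trans hab.le), max_eq_left hx, min_eq_left (by linarith),
    max_eq_left (by linarith)]
  ring

theorem zigzag_of_ge {a b x : ℝ} (hab : a < b) (hx : b ≤ x) : zigzag a b x = x := by
  rw [zigzag, min_eq_right hx, max_eq_right hab.le, min_eq_right (by linarith),
    max_eq_right (by linarith)]
  ring

theorem zigzag_of_mem {a b x : ℝ} (hx : x ∈ Icc a b) :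
    zigzag a b x = max (min (3 * x - 2 * a) (2 * (a + b) - 3 * x)) (3 * x - 2 * b) := by
  rw [zigzag, min_eq_left hx.2, max_eq_right hx.1]
  ring

theorem zigzag_mem {a b x : ℝ} (hx : x ∈ Icc a b) : zigzag a b x ∈ Icc a b := by
  obtain ⟨h1, h2⟩ := hx
  rw [zigzag_of_mem ⟨h1, h2⟩]
  constructor
  · rcases le_total (3 * x) (a + 2 * b) with h | h
    · exact le_max_of_le_left (le_min (by linarith) (by linarith))
    · exact le_max_of_le_right (by linarith)
  · refine max_le ?_ (by linarith)
    rcases le_total (3 * x) (2 * a + b) with h | h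
    · exact min_le_of_left_le (by linarith)
    · exact min_le_of_right_le (by linarith)

theorem zigzag_le_iff {a b t x : ℝ} (hab : a < b) (ht : t ∈ Ico a b) :
    zigzag a b x ≤ t ↔ x ≤ (t + 2 * a) / 3 ∨
      x ∈ Icc ((2 * (a + b) - t) / 3) ((t + 2 * b) / 3) := by
  obtain ⟨h1, h2⟩ := ht
  rcases le_total x a with hx | hx
  · rw [zigzag_of_le hab hx]
    exact ⟨fun _ => Or.inl (by linarith), fun _ => by linarith⟩
  rcases le_total b x with hx' | hx'
  · rw [zigzag_of_ge hab hx']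
    refine ⟨fun h => by linarith, ?_⟩
    rintro (h | ⟨-, h⟩) <;> linarith
  rw [zigzag_of_mem ⟨hx, hx'⟩, max_le_iff, min_le_iff, mem_Icc]
  constructor
  · rintro ⟨h | h, h'⟩
    · exact Or.inl (by linarith)
    · exact Or.inr ⟨by linarith, by linarith⟩
  · rintro (h | ⟨h, h'⟩)
    · exact ⟨Or.inl (by linarith), by linarith⟩
    · exact ⟨Or.inr (by linarith), by linarith⟩

theorem zigzag_lift {a b y v : ℝ} (hy : y ∈ Icc a b) (hv : v ∈ Icc a b) :
    ∃ y' ∈ Icc a b, zigzag a b y' = v ∧ |y' - y| = |v - zigzag a b y| / 3 := by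
  obtain ⟨h1, h2⟩ := hy
  obtain ⟨h3, h4⟩ := hv
  rw [zigzag_of_mem ⟨h1, h2⟩]
  rcases le_total (3 * y) (2 * a + b) with h | h
  · have hm : (v + 2 * a) / 3 ∈ Icc a b := ⟨by linarith, by linarith⟩
    refine ⟨(v + 2 * a) / 3, hm, ?_, ?_⟩
    · rw [zigzag_of_mem hm, min_eq_left (by linarith), max_eq_left (by linarith)]
      ring
    · rw [min_eq_left (by linarith), max_eq_left (by linarith), ← abs_of_pos (zero_lt_three' ℝ),
        ← abs_div, abs_of_pos (zero_lt_three' ℝ)]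
      congr 1
      ring
  rcases le_total (3 * y) (a + 2 * b) with h' | h'
  · have hm : (2 * (a + b) - v) / 3 ∈ Icc a b := ⟨by linarith, by linarith⟩
    refine ⟨(2 * (a + b) - v) / 3, hm, ?_, ?_⟩
    · rw [zigzag_of_mem hm, min_eq_right (by linarith), max_eq_left (by linarith)]
      ring
    · rw [min_eq_right (by linarith), max_eq_left (by linarith), ← abs_of_pos (zero_lt_three' ℝ),
        ← abs_div, abs_of_pos (zero_lt_three' ℝ), ← abs_neg]
      congr 1
      ring
  · have hm : (v + 2 * b) / 3 ∈ Icc a b := ⟨by linarith, by linarith⟩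
    refine ⟨(v + 2 * b) / 3, hm, ?_, ?_⟩
    · rw [zigzag_of_mem hm, min_eq_right (by linarith), max_eq_right (by linarith)]
      ring
    · rw [min_eq_right (by linarith), max_eq_right (by linarith), ← abs_of_pos (zero_lt_three' ℝ),
        ← abs_div, abs_of_pos (zero_lt_three' ℝ)]
      congr 1
      ring

theorem zigzag_mem_unitInterval {a b : unitInterval} (hab : a < b) (x : unitInterval) :
    zigzag a b x ∈ unitInterval := by
  rcases le_total x a with h | h
  · rw [zigzag_of_le hab h]
    exact x.2
  rcases le_total b x with h' | h'
  · rw [zigzag_of_ge hab h']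
    exact x.2
  · have := zigzag_mem (a := a) (b := b) (x := x) ⟨h, h'⟩
    exact ⟨a.2.1.trans this.1, this.2.trans b.2.2⟩

/-- `zigzag a b` as a continuous self-map of the unit interval. -/
def zigzagMap {a b : unitInterval} (hab : a < b) : C(unitInterval, unitInterval) where
  toFun x := ⟨zigzag a b x, zigzag_mem_unitInterval hab x⟩
  continuous_toFun := ((continuous_zigzag a b).comp continuous_subtype_val).subtype_mk _

theorem zigzagMap_eq_self {a b : unitInterval} (hab : a < b) {x : unitInterval}
    (hx : x ∉ Ioo a b) : zigzagMap hab x = x := by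
  apply Subtype.ext
  rcases le_or_gt x a with h | h
  · exact zigzag_of_le hab h
  · exact zigzag_of_ge hab (not_lt.1 fun h' => hx ⟨h, h'⟩)

theorem mapsTo_zigzagMap {a b : unitInterval} (hab : a < b) :
    MapsTo (zigzagMap hab) (Icc a b) (Icc a b) := fun x hx =>
  zigzag_mem (a := a) (b := b) (x := x) hx

theorem measPres_zigzagMap {a b : unitInterval} (hab : a < b) : MeasPres (zigzagMap hab) := by
  apply measPres_of_Iic
  intro t
  by_cases ht : t ∈ Ico a b
  · have ht0 := t.2.1
    have ha0 := a.2.1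
    have hb1 := b.2.2
    have ht' : (t : ℝ) ∈ Ico (a : ℝ) b := ht
    have hbt : (t : ℝ) < b := ht.2
    have hat : (a : ℝ) ≤ t := ht.1
    let c : unitInterval := ⟨(t + 2 * a) / 3, by linarith, by linarith⟩
    let d : unitInterval := ⟨(2 * (a + b) - t) / 3, by linarith, by linarith⟩
    let e : unitInterval := ⟨(t + 2 * b) / 3, by linarith, by linarith⟩
    have hpre : zigzagMap hab ⁻¹' Iic t = Icc 0 c ∪ Icc d e := by
      ext x
      have := zigzag_le_iff (x := x) hab ht'
      constructor
      · intro hx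
        exact (this.1 hx).imp (fun h => ⟨x.2.1, h⟩) id
      · intro hx
        exact this.2 (hx.imp (fun h => h.2) id)
    have hdisj : Disjoint (Icc 0 c) (Icc d e) := by
      rw [Set.disjoint_left]
      intro x hx hx'
      have h1 : (x : ℝ) ≤ (t + 2 * a) / 3 := hx.2
      have h2 : (2 * (a + b) - t) / 3 ≤ (x : ℝ) := hx'.1
      linarith
    have hI : Iic t = Icc 0 t := Icc_bot.symm
    rw [hpre, measure_union hdisj measurableSet_Icc, hI, lebI_Icc, lebI_Icc, lebI_Icc,
      ← ENNReal.ofReal_add]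
    · congr 1
      simp only [c, d, e, Icc.coe_zero]
      ring
    · rw [Icc.coe_zero, sub_zero]
      exact c.2.1
    · simp only [d, e]
      linarith
  · congr 1
    ext x
    by_cases hx : x ∈ Ioo a b
    · have hm := mapsTo_zigzagMap hab (Ioo_subset_Icc_self hx)
      rcases lt_or_ge t a with h | h
      · exact iff_of_false (fun h' => (h.trans_le hm.1).not_ge h')
          (fun h' => (h.trans hx.1).not_ge h')
      · have hbt : b ≤ t := not_lt.1 fun h' => ht ⟨h, h'⟩
        exact iff_of_true (hm.2.trans hbt) (hx.2.le.trans hbt)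
    · rw [mem_preimage, zigzagMap_eq_self hab hx]

theorem zigzagMap_lift {a b : unitInterval} (hab : a < b) {y v : unitInterval}
    (hy : y ∈ Icc a b) (hv : v ∈ Icc a b) :
    ∃ y' ∈ Icc a b, zigzagMap hab y' = v ∧ dist y' y = dist v (zigzagMap hab y) / 3 := by
  obtain ⟨y', hm, h1, h2⟩ := zigzag_lift (a := a) (b := b) (y := y) (v := v) hy hv
  exact ⟨⟨y', a.2.1.trans hm.1, hm.2.trans b.2.2⟩, hm, Subtype.ext h1, h2⟩

/-- There are measure-preserving maps supported on `[a, b]` all of whose fibres over `[a, b]` are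
arbitrarily dense in `[a, b]`. -/
theorem exists_measPres_dense_fibres {a b : unitInterval} (hab : a < b) {θ : ℝ} (hθ : 0 < θ) :
    ∃ h : C(unitInterval, unitInterval), MeasPres h ∧ (∀ x ∉ Icc a b, h x = x) ∧
      MapsTo h (Icc a b) (Icc a b) ∧
      ∀ y ∈ Icc a b, ∀ v ∈ Icc a b, ∃ y' ∈ Icc a b, h y' = v ∧ dist y' y ≤ θ := by
  suffices H : ∀ n : ℕ, ∃ h : C(unitInterval, unitInterval), MeasPres h ∧
      (∀ x ∉ Icc a b, h x = x) ∧ MapsTo h (Icc a b) (Icc a b) ∧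
      ∀ y ∈ Icc a b, ∀ v ∈ Icc a b, ∃ y' ∈ Icc a b, h y' = v ∧ dist y' y ≤ (1 / 3) ^ n by
    obtain ⟨n, hn⟩ := exists_pow_lt_of_lt_one hθ (show (1 / 3 : ℝ) < 1 by norm_num)
    obtain ⟨h, h1, h2, h3, h4⟩ := H n
    refine ⟨h, h1, h2, h3, fun y hy v hv => ?_⟩
    obtain ⟨y', hy', h5, h6⟩ := h4 y hy v hv
    exact ⟨y', hy', h5, h6.trans hn.le⟩
  intro n
  induction n with
  | zero =>
    refine ⟨ContinuousMap.id _, fun A _ => rfl, fun _ _ => rfl, fun _ hx => hx,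
      fun y _ v hv => ⟨v, hv, rfl, ?_⟩⟩
    rw [pow_zero]
    exact Real.dist_le_of_mem_Icc_01 v.2 y.2
  | succ n ih =>
    obtain ⟨h, h1, h2, h3, h4⟩ := ih
    refine ⟨h.comp (zigzagMap hab), h1.comp (measPres_zigzagMap hab), fun x hx => ?_,
      h3.comp (mapsTo_zigzagMap hab), fun y hy v hv => ?_⟩
    · rw [ContinuousMap.comp_apply, zigzagMap_eq_self hab fun h' => hx (Ioo_subset_Icc_self h'),
        h2 x hx]
    · obtain ⟨v', hv', h5, h6⟩ := h4 _ (mapsTo_zigzagMap hab hy) v hv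
      obtain ⟨y', hy', h7, h8⟩ := zigzagMap_lift hab hy hv'
      refine ⟨y', hy', by rw [ContinuousMap.comp_apply, h7, h5], ?_⟩
      rw [h8, pow_succ]
      linarith

/-- The graph of `F` strictly crosses the diagonal, in alternating directions, between three
consecutive points of `U`. -/
def CrossesTwice (F : unitInterval → unitInterval) (U : Set unitInterval) : Prop :=
  ∃ y₁ ∈ U, ∃ y₂ ∈ U, ∃ y₃ ∈ U, y₁ < y₂ ∧ y₂ < y₃ ∧
    ((F y₁ < y₁ ∧ y₂ < F y₂ ∧ F y₃ < y₃) ∨ (y₁ < F y₁ ∧ F y₂ < y₂ ∧ y₃ < F y₃))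

theorem continuous_iterate_eval (k : ℕ) (x : unitInterval) :
    Continuous fun f : C(unitInterval, unitInterval) => f^[k] x := by
  induction k with
  | zero => exact continuous_const
  | succ k ih =>
    simp only [Function.iterate_succ_apply']
    exact continuous_id.eval ih

theorem isOpen_setOf_crossesTwice (k : ℕ) (U : Set unitInterval) :
    IsOpen {f : CLam | CrossesTwice (f.1)^[k] U} := by
  have hc (x : unitInterval) : Continuous fun f : CLam => (f.1)^[k] x :=
    (continuous_iterate_eval k x).comp continuous_subtype_val
  have hlt (x : unitInterval) : IsOpen {f : CLam | (f.1)^[k] x < x} :=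
    isOpen_lt (hc x) continuous_const
  have hgt (x : unitInterval) : IsOpen {f : CLam | x < (f.1)^[k] x} :=
    isOpen_lt continuous_const (hc x)
  have : {f : CLam | CrossesTwice (f.1)^[k] U} = ⋃ y₁ ∈ U, ⋃ y₂ ∈ U, ⋃ y₃ ∈ U,
      ⋃ (_ : y₁ < y₂), ⋃ (_ : y₂ < y₃),
        ({f : CLam | (f.1)^[k] y₁ < y₁} ∩ ({f : CLam | y₂ < (f.1)^[k] y₂} ∩
          {f : CLam | (f.1)^[k] y₃ < y₃})) ∪
        ({f : CLam | y₁ < (f.1)^[k] y₁} ∩ ({f : CLam | (f.1)^[k] y₂ < y₂} ∩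
          {f : CLam | y₃ < (f.1)^[k] y₃})) := by
    ext f
    simp only [CrossesTwice, mem_iUnion, mem_union, mem_inter_iff, mem_ofPred_eq, exists_prop]
  rw [this]
  exact isOpen_biUnion fun y₁ _ => isOpen_biUnion fun y₂ _ => isOpen_biUnion fun y₃ _ =>
    isOpen_iUnion fun _ => isOpen_iUnion fun _ =>
      ((hlt _).inter ((hgt _).inter (hlt _))).union ((hgt _).inter ((hlt _).inter (hgt _)))

theorem exists_fixed_point_between {F : unitInterval → unitInterval} (hF : Continuous F)
    {x y : unitInterval} (hxy : x < y) (h : (F x < x ∧ y < F y) ∨ (x < F x ∧ F y < y)) :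
    ∃ z ∈ Ioo x y, F z = z := by
  obtain ⟨z, hz, hFz⟩ : ∃ z ∈ Icc x y, F z = z := by
    rcases h with ⟨h1, h2⟩ | ⟨h1, h2⟩
    · exact isPreconnected_Icc.intermediate_value₂ (left_mem_Icc.2 hxy.le)
        (right_mem_Icc.2 hxy.le) hF.continuousOn continuousOn_id h1.le h2.le
    · obtain ⟨z, hz, h⟩ := isPreconnected_Icc.intermediate_value₂ (left_mem_Icc.2 hxy.le)
        (right_mem_Icc.2 hxy.le) continuousOn_id hF.continuousOn h1.le h2.le
      exact ⟨z, hz, h.symm⟩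
  refine ⟨z, ⟨hz.1.lt_of_ne ?_, hz.2.lt_of_ne ?_⟩, hFz⟩
  · rintro rfl
    rcases h with ⟨h1, -⟩ | ⟨h1, -⟩ <;> simp [hFz] at h1
  · rintro rfl
    rcases h with ⟨-, h1⟩ | ⟨-, h1⟩ <;> simp [hFz] at h1

theorem CrossesTwice.exists_fixed_ne {F : unitInterval → unitInterval} (hF : Continuous F)
    {U : Set unitInterval} (hU : U.OrdConnected) (h : CrossesTwice F U) (p : unitInterval) :
    ∃ z ∈ U, F z = z ∧ z ≠ p := by
  obtain ⟨y₁, h1, y₂, h2, y₃, h3, h12, h23, h⟩ := h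
  obtain ⟨z, hz, hFz⟩ := exists_fixed_point_between hF h12
    (h.imp (fun h => ⟨h.1, h.2.1⟩) fun h => ⟨h.1, h.2.1⟩)
  obtain ⟨w, hw, hFw⟩ := exists_fixed_point_between hF h23
    (h.symm.imp (fun h => ⟨h.2.1, h.2.2⟩) fun h => ⟨h.2.1, h.2.2⟩)
  by_cases hzp : z = p
  · exact ⟨w, hU.out h2 h3 (Ioo_subset_Icc_self hw), hFw,
      fun h => (hz.2.trans hw.1).ne (hzp.trans h.symm)⟩
  · exact ⟨z, hU.out h1 h2 (Ioo_subset_Icc_self hz), hFz, hzp⟩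

theorem CrossesTwice.exists_not_fixed {F : unitInterval → unitInterval}
    {U : Set unitInterval} (h : CrossesTwice F U) : ∃ z ∈ U, F z ≠ z := by
  obtain ⟨y₁, h1, _, _, _, _, _, _, h | h⟩ := h
  · exact ⟨y₁, h1, h.1.ne⟩
  · exact ⟨y₁, h1, h.1.ne'⟩

theorem CrossesTwice.mono {F : unitInterval → unitInterval} {U V : Set unitInterval}
    (h : CrossesTwice F U) (hUV : U ⊆ V) : CrossesTwice F V := by
  obtain ⟨y₁, h1, y₂, h2, y₃, h3, h⟩ := h
  exact ⟨y₁, hUV h1, y₂, hUV h2, y₃, hUV h3, h⟩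

theorem exists_mem_Icc_iterate_ne {f : C(unitInterval, unitInterval)} (hf : MeasPres f) (m : ℕ)
    {a b : unitInterval} (hab : a < b) (p : unitInterval) : ∃ w ∈ Icc a b, f^[m] w ≠ p := by
  by_contra! H
  have h := (hf.measurePreserving.iterate m).measure_preimage
    (measurableSet_singleton p).nullMeasurableSet
  have hp : lebI {p} = 0 := by
    rw [← Icc_self, lebI_Icc, sub_self, ENNReal.ofReal_zero]
  have hle : lebI (Icc a b) ≤ lebI (f^[m] ⁻¹' {p}) := measure_mono H
  rw [h, hp, lebI_Icc, nonpos_iff_eq_zero, ENNReal.ofReal_eq_zero, sub_nonpos] at hle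
  exact hab.not_ge hle

/-- If `h` is supported on `J` and `J` does not return to itself before time `m`, precomposing `f`
with `h` only affects the first of the first `m` steps. -/
theorem iterate_comp_eq {X : Type*} {f h : X → X} {J : Set X} {m : ℕ}
    (hid : ∀ x ∉ J, h x = x) (hJ : MapsTo h J J) (hm : ∀ i, 0 < i → i < m → ∀ x ∈ J, f^[i] x ∉ J)
    {y : X} (hy : y ∈ J) {i : ℕ} (hi : 0 < i) (him : i ≤ m) :
    (f ∘ h)^[i] y = f^[i] (h y) := by
  induction i, hi using Nat.le_induction with
  | base => rfl
  | succ i hi ih =>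
    rw [Function.iterate_succ_apply', Function.iterate_succ_apply', ih (by omega),
      Function.comp_apply, hid _ (hm i (by omega) (by omega) _ (hJ hy))]

theorem exists_Icc_nhds (p : unitInterval) {U : Set unitInterval} (hU : U ∈ 𝓝 p) :
    ∃ a b : unitInterval, a < b ∧ p ∈ Icc a b ∧ Icc a b ∈ 𝓝 p ∧ Icc a b ⊆ U := by
  obtain ⟨a, b, hp, hn, hs⟩ := exists_Icc_mem_subset_of_mem_nhds hU
  refine ⟨a, b, lt_of_le_of_ne (hp.1.trans hp.2) ?_, hp, hn, hs⟩
  rintro rfl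
  rw [Icc_self] at hn
  have : (𝓝[≠] p).NeBot := inferInstance
  obtain rfl := hp.1.antisymm hp.2
  have := (mem_closure_iff_nhds.1 (mem_closure_iff_nhdsWithin_neBot.2 this)) _ hn
  simp at this

theorem exists_mem_uIcc_coe_eq (p u : unitInterval) {s : ℝ} (hs : s ∈ Icc (0 : ℝ) 1) :
    ∃ c ∈ uIcc p u, (c : ℝ) = p + s * (u - p) := by
  obtain ⟨h0, h1⟩ := hs
  rcases le_total p u with h | h
  · have h' : (p : ℝ) ≤ u := h
    have h2 : 0 ≤ s * ((u : ℝ) - p) := mul_nonneg h0 (sub_nonneg.2 h')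
    have h3 : 0 ≤ (1 - s) * ((u : ℝ) - p) :=
      mul_nonneg (sub_nonneg.2 h1) (sub_nonneg.2 h')
    have hp := p.2.1
    have hu := u.2.2
    refine ⟨⟨p + s * (u - p), by linarith, by linarith⟩, ?_, rfl⟩
    rw [uIcc_of_le h]
    exact ⟨show (p : ℝ) ≤ p + s * (u - p) by linarith,
      show (p : ℝ) + s * (u - p) ≤ u by linarith⟩
  · have h' : (u : ℝ) ≤ p := h
    have h2 : 0 ≤ s * ((p : ℝ) - u) := mul_nonneg h0 (sub_nonneg.2 h')
    have h3 : 0 ≤ (1 - s) * ((p : ℝ) - u) :=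
      mul_nonneg (sub_nonneg.2 h1) (sub_nonneg.2 h')
    have hp := p.2.2
    have hu := u.2.1
    refine ⟨⟨p + s * (u - p), by linarith, by linarith⟩, ?_, rfl⟩
    rw [uIcc_of_ge h]
    exact ⟨show (u : ℝ) ≤ p + s * (u - p) by linarith,
      show (p : ℝ) + s * (u - p) ≤ p by linarith⟩

theorem exists_forall_dist_le_mem_uIcc (p u : unitInterval) :
    ∃ c ∈ uIcc p u, ∀ y, dist y c ≤ dist u p / 16 → y ∈ uIcc p u := by
  obtain ⟨c, hc, e⟩ := exists_mem_uIcc_coe_eq p u (s := 1 / 2) (by norm_num)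
  refine ⟨c, hc, fun y hy => ?_⟩
  rw [Subtype.dist_eq, Subtype.dist_eq, Real.dist_eq, Real.dist_eq, abs_le] at hy
  rcases le_total p u with h | h
  · have h' : (p : ℝ) ≤ u := h
    rw [abs_of_nonneg (sub_nonneg.2 h')] at hy
    rw [uIcc_of_le h]
    exact ⟨show (p : ℝ) ≤ y by linarith, show (y : ℝ) ≤ u by linarith⟩
  · have h' : (u : ℝ) ≤ p := h
    rw [abs_of_nonpos (sub_nonpos.2 h')] at hy
    rw [uIcc_of_ge h]
    exact ⟨show (u : ℝ) ≤ y by linarith, show (y : ℝ) ≤ p by linarith⟩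

theorem crossesTwice_of_forall_dist_le {G : unitInterval → unitInterval} {p u : unitInterval}
    (hpu : u ≠ p) {U : Set unitInterval}
    (H : ∀ v ∈ uIcc p u, ∀ c ∈ uIcc p u, ∃ y ∈ U, dist y c ≤ dist u p / 16 ∧ G y = v) :
    CrossesTwice G U := by
  obtain ⟨c₁, hc₁, e₁⟩ := exists_mem_uIcc_coe_eq p u (s := 1 / 4) (by norm_num)
  obtain ⟨c₂, hc₂, e₂⟩ := exists_mem_uIcc_coe_eq p u (s := 1 / 2) (by norm_num)
  obtain ⟨c₃, hc₃, e₃⟩ := exists_mem_uIcc_coe_eq p u (s := 3 / 4) (by norm_num)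
  obtain ⟨y₁, hy₁, d₁, g₁⟩ := H p left_mem_uIcc c₁ hc₁
  obtain ⟨y₂, hy₂, d₂, g₂⟩ := H u right_mem_uIcc c₂ hc₂
  obtain ⟨y₃, hy₃, d₃, g₃⟩ := H p left_mem_uIcc c₃ hc₃
  rw [Subtype.dist_eq, Subtype.dist_eq, Real.dist_eq, Real.dist_eq, abs_le] at d₁ d₂ d₃
  rcases lt_or_gt_of_ne hpu with h | h
  · have h' : (u : ℝ) < p := h
    rw [abs_of_neg (sub_neg.2 h')] at d₁ d₂ d₃
    refine ⟨y₃, hy₃, y₂, hy₂, y₁, hy₁, ?_, ?_, Or.inr ⟨?_, ?_, ?_⟩⟩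
    all_goals
      try simp only [g₁, g₂, g₃]
      rw [← Subtype.coe_lt_coe]
      linarith
  · have h' : (p : ℝ) < u := h
    rw [abs_of_pos (sub_pos.2 h')] at d₁ d₂ d₃
    refine ⟨y₁, hy₁, y₂, hy₂, y₃, hy₃, ?_, ?_, Or.inl ⟨?_, ?_, ?_⟩⟩
    all_goals
      try simp only [g₁, g₂, g₃]
      rw [← Subtype.coe_lt_coe]
      linarith

theorem exists_uIcc_subset_image {F : unitInterval → unitInterval} (hF : Continuous F)
    {a b p w : unitInterval} (hp : p ∈ Icc a b) (hn : Icc a b ∈ 𝓝 p) (hFp : F p = p)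
    (hw : w ∈ Icc a b) (hFw : F w ≠ p) :
    ∃ u, u ≠ p ∧ uIcc p u ⊆ Icc a b ∧ uIcc p u ⊆ F '' Icc a b := by
  have hconn : (F '' Icc a b).OrdConnected :=
    (isPreconnected_Icc.image F hF.continuousOn).ordConnected
  have hpI : p ∈ F '' Icc a b := ⟨p, hp, hFp⟩
  have hwI : F w ∈ F '' Icc a b := mem_image_of_mem F hw
  rcases lt_or_gt_of_ne hFw with h | h
  · have : (𝓝[<] p).NeBot := nhdsLT_neBot_of_exists_lt ⟨_, h⟩
    obtain ⟨q, hq, hqp⟩ := Filter.nonempty_of_mem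
      (inter_mem (mem_nhdsWithin_of_mem_nhds hn) (self_mem_nhdsWithin (s := Iio p)))
    have hlt : max q (F w) < p := max_lt hqp h
    refine ⟨max q (F w), hlt.ne, ordConnected_Icc.uIcc_subset hp
      ⟨hq.1.trans (le_max_left _ _), hlt.le.trans hp.2⟩, ?_⟩
    exact hconn.uIcc_subset hpI (hconn.out hwI hpI ⟨le_max_right _ _, hlt.le⟩)
  · have : (𝓝[>] p).NeBot := nhdsGT_neBot_of_exists_gt ⟨_, h⟩
    obtain ⟨q, hq, hqp⟩ := Filter.nonempty_of_mem
      (inter_mem (mem_nhdsWithin_of_mem_nhds hn) (self_mem_nhdsWithin (s := Ioi p)))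
    have hlt : p < min q (F w) := lt_min hqp h
    refine ⟨min q (F w), hlt.ne', ordConnected_Icc.uIcc_subset hp
      ⟨hp.1.trans hlt.le, (min_le_left _ _).trans hq.2⟩, ?_⟩
    exact hconn.uIcc_subset hpI (hconn.out hpI hwI ⟨hlt.le, min_le_right _ _⟩)

/-- Near any fixed point of `f^[k]`, the map `f` can be perturbed so that the graph of its `k`-th
iterate crosses the diagonal twice. -/
theorem MeasPres.exists_dist_lt_crossesTwice {f : C(unitInterval, unitInterval)} (hf : MeasPres f)
    {k : ℕ} (hk : 1 ≤ k) {p : unitInterval} (hp : f^[k] p = p) {U : Set unitInterval}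
    (hU : U ∈ 𝓝 p) {ε : ℝ} (hε : 0 < ε) :
    ∃ g : C(unitInterval, unitInterval), MeasPres g ∧ dist g f < ε ∧ CrossesTwice g^[k] U := by
  have hper : Function.IsPeriodicPt f k p := hp
  obtain ⟨l, hl⟩ := hper.minimalPeriod_dvd
  set m := Function.minimalPeriod f p with hm
  have hl1 : 1 ≤ l := by
    rw [Nat.one_le_iff_ne_zero]
    rintro rfl
    omega
  have hFp : f^[m] p = p := Function.isPeriodicPt_minimalPeriod f p
  have hm0 : 0 < m := hper.minimalPeriod_pos hk
  have hiter (i : ℕ) : Continuous f^[i] := f.continuous.iterate i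
  obtain ⟨V, hV, hVm⟩ : ∃ V ∈ 𝓝 p, ∀ x ∈ V, ∀ y ∈ V, ∀ i ∈ Ioo 0 m, f^[i] x ≠ y := by
    rw [← Filter.eventually_prod_self_iff (r := fun x y => ∀ i ∈ Ioo 0 m, f^[i] x ≠ y),
      ← nhds_prod_eq, Filter.eventually_all_finite (finite_Ioo 0 m)]
    intro i hi
    have : Continuous fun q : unitInterval × unitInterval => f^[i] q.1 := (hiter i).comp
      continuous_fst
    exact (isOpen_ne_fun this continuous_snd).mem_nhds
      (Function.not_isPeriodicPt_of_pos_of_lt_minimalPeriod hi.1.ne' hi.2)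
  obtain ⟨δ, hδ, hfδ⟩ := Metric.uniformContinuous_iff.1
    (CompactSpace.uniformContinuous_of_continuous f.continuous) (ε / 2) (half_pos hε)
  obtain ⟨a, b, hab, hpJ, hJ, hJs⟩ := exists_Icc_nhds p
    (inter_mem hU (inter_mem hV (ball_mem_nhds p (half_pos hδ))))
  obtain ⟨w, hw, hFw⟩ := exists_mem_Icc_iterate_ne hf m hab p
  obtain ⟨u, hup, hK, hKF⟩ := exists_uIcc_subset_image (hiter m) hpJ hJ hFp hw hFw
  have hθ : 0 < dist u p / 16 := div_pos (dist_pos.2 hup) (by norm_num)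
  obtain ⟨h, h1, hid, hmaps, hdense⟩ := exists_measPres_dense_fibres hab hθ
  have hgm {y : unitInterval} (hy : y ∈ Icc a b) : (f ∘ h)^[m] y = f^[m] (h y) :=
    iterate_comp_eq hid hmaps
      (fun i hi him x hx hx' => hVm x (hJs hx).2.1 _ (hJs hx').2.1 i ⟨hi, him⟩ rfl) hy hm0 le_rfl
  have hstep : ∀ v ∈ uIcc p u, ∀ c ∈ Icc a b,
      ∃ y ∈ Icc a b, dist y c ≤ dist u p / 16 ∧ (f ∘ h)^[m] y = v := by
    intro v hv c hc
    obtain ⟨w, hw, rfl⟩ := hKF hv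
    obtain ⟨y, hy, hyw, hyc⟩ := hdense c hc w hw
    exact ⟨y, hy, hyc, by rw [hgm hy, hyw]⟩
  have hsteps : ∀ n ≥ 1, ∀ v ∈ uIcc p u, ∀ c ∈ uIcc p u,
      ∃ y ∈ Icc a b, dist y c ≤ dist u p / 16 ∧ (f ∘ h)^[m * n] y = v := by
    intro n hn v hv
    induction n, hn using Nat.le_induction with
    | base =>
      intro c hc
      rw [mul_one]
      exact hstep v hv c (hK hc)
    | succ n _ ih =>
      intro c hc
      obtain ⟨c', hc', hball⟩ := exists_forall_dist_le_mem_uIcc p u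
      obtain ⟨z, -, hzc, hz⟩ := ih c' hc'
      obtain ⟨y, hy, hyc, hyz⟩ := hstep z (hball z hzc) c (hK hc)
      exact ⟨y, hy, hyc, by rw [Nat.mul_succ, Function.iterate_add_apply, hyz, hz]⟩
  refine ⟨f.comp h, hf.comp h1, ?_, ?_⟩
  · refine lt_of_le_of_lt ((ContinuousMap.dist_le (half_pos hε).le).2 fun x => ?_)
      (half_lt_self hε)
    rw [ContinuousMap.comp_apply]
    by_cases hx : x ∈ Icc a b
    · have hx1 : dist x p < δ / 2 := (hJs hx).2.2
      have hx2 : dist (h x) p < δ / 2 := (hJs (hmaps hx)).2.2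
      refine (hfδ ?_).le
      linarith [dist_triangle_right (h x) x p]
    · rw [hid x hx, dist_self]
      exact (half_pos hε).le
  · rw [ContinuousMap.coe_comp, hl]
    refine crossesTwice_of_forall_dist_le hup fun v hv c hc => ?_
    obtain ⟨y, hy, h'⟩ := hsteps l hl1 v hv c hc
    exact ⟨y, (hJs hy).1, h'⟩

theorem generic_Fix_is_Cantor :
    ∃ R : Set ↥CLam, R ∈ residual ↥CLam ∧
      ∀ f ∈ R, ∀ k : ℕ, 1 ≤ k → IsCantorSet (FixSet (⇑f.1) k) := by
  let A (k : ℕ) (B : Set unitInterval) : Set CLam := {f | CrossesTwice (f.1)^[k] B}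
  let 𝓑 := TopologicalSpace.countableBasis unitInterval
  refine ⟨⋂ k, ⋂ B ∈ 𝓑, (A k B ∪ (closure (A k B))ᶜ), ?_, fun f hf k hk => ?_⟩
  · refine countable_iInter_mem.2 fun k =>
      (countable_bInter_mem (TopologicalSpace.countable_countableBasis _)).2 fun B _ => ?_
    refine residual_of_dense_open
      ((isOpen_setOf_crossesTwice k B).union isClosed_closure.isOpen_compl) fun g => ?_
    by_cases hg : g ∈ closure (A k B)
    · exact closure_mono subset_union_left hg
    · exact subset_closure (Or.inr hg)
  have hcont : Continuous (f.1)^[k] := f.1.continuous.iterate k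
  have hcross : ∀ p ∈ FixSet f.1 k, ∀ U ∈ 𝓝 p, CrossesTwice (f.1)^[k] U := by
    intro p hp U hU
    obtain ⟨B, hB, hpB, hBU⟩ :=
      (TopologicalSpace.isBasis_countableBasis unitInterval).mem_nhds_iff.1 hU
    have hBn : B ∈ 𝓝 p :=
      (TopologicalSpace.isBasis_countableBasis unitInterval).mem_nhds hB hpB
    have hcl : f ∈ closure (A k B) := by
      refine Metric.mem_closure_iff.2 fun ε hε => ?_
      obtain ⟨g, hg, hgf, hgB⟩ := MeasPres.exists_dist_lt_crossesTwice f.2 hk hp hBn hε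
      exact ⟨⟨g, hg⟩, hgB, by rwa [dist_comm]⟩
    rcases mem_iInter₂.1 (mem_iInter.1 hf k) B hB with h | h
    · exact h.mono hBU
    · exact absurd hcl h
  have hclosed : IsClosed (FixSet f.1 k) := isClosed_eq hcont continuous_id
  refine ⟨?_, hclosed.isCompact, ⟨hclosed, fun p hp => ?_⟩, fun t ht htc => ?_⟩
  · obtain ⟨x, -, hx⟩ := isPreconnected_univ.intermediate_value₂ (mem_univ (0 : unitInterval))
      (mem_univ 1) continuousOn_id hcont.continuousOn bot_le le_top
    exact ⟨x, hx.symm⟩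
  · refine accPt_iff_nhds.2 fun U hU => ?_
    obtain ⟨a, b, -, -, hn, hs⟩ := exists_Icc_nhds p hU
    obtain ⟨z, hz, hFz, hzp⟩ := (hcross p hp _ hn).exists_fixed_ne hcont ordConnected_Icc p
    exact ⟨z, ⟨hs hz, hFz⟩, hzp⟩
  · by_contra hns
    obtain ⟨x, hx, y, hy, hxy⟩ := (not_subsingleton_iff.1 hns).exists_lt
    have hsub : Icc x y ⊆ FixSet f.1 k := (htc.Icc_subset hx hy).trans ht
    obtain ⟨z, hz⟩ := exists_between hxy
    obtain ⟨z', hz', hne⟩ := (hcross z (hsub (Ioo_subset_Icc_self hz)) _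
      (Ioo_mem_nhds hz.1 hz.2)).exists_not_fixed
    exact hne (hsub (Ioo_subset_Icc_self hz'))
end
end

section
/- For a generic map f in C_λ(I) (i.e., for every f in some residual subset of C_λ(I)) and for every integer k ≥ 1, the Hausdorff dimension of the set Fix(f,k) = {x ∈ [0,1] : f^k(x) = x} is zero; in particular the Hausdorff dimension of Per(f,k) is zero. -/
open MeasureTheory Set Metric Filter Topology

noncomputable section

/-- `Per(f,k) = {x : f^k x = x and f^i x ≠ x for 1 ≤ i < k}`. -/
def PerSet {X : Type*} (f : X → X) (k : ℕ) : Set X :=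
  {x | f^[k] x = x ∧ ∀ i : ℕ, 1 ≤ i → i < k → f^[i] x ≠ x}

/-- `Per(f) = ⋃_{k ≥ 1} Fix(f,k)`, the set of all periodic points. -/
def PerAll {X : Type*} (f : X → X) : Set X := ⋃ k ∈ {k : ℕ | 1 ≤ k}, FixSet f k

open unitInterval

lemma lebI_eq_volume : lebI = volume := rfl

lemma volume_pos_of_mem_nhds_unitInterval {U : Set I} {z : I} (hU : U ∈ 𝓝 z) :
    0 < (volume : Measure I) U := by
  rcases eq_or_ne z 0 with rfl | hz
  · obtain ⟨u, hu, hsub⟩ := exists_Ico_subset_of_mem_nhds hU ⟨1, zero_lt_one⟩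
    refine lt_of_lt_of_le ?_ (measure_mono hsub)
    simpa using hu
  · have hz0 : 0 < z := unitInterval.pos_iff_ne_zero.2 hz
    obtain ⟨u, hu, hsub⟩ := exists_Ioc_subset_of_mem_nhds hU ⟨0, hz0⟩
    refine lt_of_lt_of_le ?_ (measure_mono hsub)
    simpa using hu

/-- The distribution function of `q` (with respect to Lebesgue measure on `[0,1]`), evaluated
along `q` itself. -/
def levelMap (q : C(I, ℝ)) (x : I) : I :=
  ⟨(volume : Measure I).real {t | q t ≤ q x}, measureReal_nonneg, measureReal_le_one⟩

lemma measurableSet_le_level (q : C(I, ℝ)) (c : ℝ) : MeasurableSet {t : I | q t ≤ c} :=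
  (isClosed_le q.continuous continuous_const).measurableSet

lemma levelMap_mono {q : C(I, ℝ)} {x y : I} (h : q x ≤ q y) : levelMap q x ≤ levelMap q y :=
  measureReal_mono (μ := (volume : Measure I)) fun _ ht => le_trans ht h

lemma continuous_levelMap {q : C(I, ℝ)}
    (hq : ∀ c, (volume : Measure I) {t | q t = c} = 0) : Continuous (levelMap q) := by
  refine Continuous.subtype_mk ?_ _
  have hrep : (fun x => (volume : Measure I).real {t | q t ≤ q x}) =
      fun x => ∫ t, {t : I | q t ≤ q x}.indicator (fun _ => (1 : ℝ)) t := by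
    ext x
    rw [integral_indicator (measurableSet_le_level q _)]
    simp
  rw [hrep, continuous_iff_continuousAt]
  intro x
  refine continuousAt_of_dominated (bound := fun _ => 1) ?_ ?_ (integrable_const _) ?_
  · refine Eventually.of_forall fun y => ?_
    exact (aestronglyMeasurable_const.indicator (measurableSet_le_level q _))
  · refine Eventually.of_forall fun y => Eventually.of_forall fun t => ?_
    by_cases h : q t ≤ q y <;> simp [indicator, h]
  · have : ∀ᵐ t : I, q t ≠ q x := by
      rw [ae_iff]; simpa using hq (q x)
    filter_upwards [this] with t ht
    rcases lt_or_gt_of_ne ht with h | h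
    · have : ∀ᶠ y in 𝓝 x, q t < q y := q.continuous.continuousAt.eventually_const_lt h
      refine continuousAt_const (y := (1 : ℝ)) |>.congr ?_
      filter_upwards [this] with y hy
      simp [indicator, hy.le]
    · have : ∀ᶠ y in 𝓝 x, q y < q t := q.continuous.continuousAt.eventually_lt_const h
      refine continuousAt_const (y := (0 : ℝ)) |>.congr ?_
      filter_upwards [this] with y hy
      simp [indicator, hy]

lemma volume_levelMap_le {q : C(I, ℝ)}
    (hq : ∀ c, (volume : Measure I) {t | q t = c} = 0) (c : I) :
    (volume : Measure I) {x | levelMap q x ≤ c} = ENNReal.ofReal c := by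
  have hcont := continuous_levelMap hq
  obtain ⟨a, -, ha⟩ := isCompact_univ.exists_isMinOn univ_nonempty q.continuous.continuousOn
  obtain ⟨b, -, hb⟩ := isCompact_univ.exists_isMaxOn univ_nonempty q.continuous.continuousOn
  have hga : levelMap q a = 0 := by
    ext
    have : {t | q t ≤ q a} = {t | q t = q a} := by
      ext t; exact ⟨fun h => le_antisymm h (ha (mem_univ t)), fun h => le_of_eq h⟩
    simp [levelMap, this, Measure.real, hq]
  have hgb : levelMap q b = 1 := by
    ext
    have : {t | q t ≤ q b} = univ := by
      ext t; simpa using hb (mem_univ t)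
    simp [levelMap, this]
  obtain ⟨x₁, hx₁⟩ : c ∈ range (levelMap q) := by
    refine mem_range_of_exists_le_of_exists_ge hcont ⟨a, ?_⟩ ⟨b, ?_⟩
    · rw [hga]; exact c.2.1
    · rw [hgb]; exact c.2.2
  have hK : IsCompact {x | levelMap q x ≤ c} :=
    (isClosed_le hcont continuous_const).isCompact
  obtain ⟨x₀, hx₀, hmax⟩ := hK.exists_isMaxOn ⟨x₁, hx₁.le⟩ q.continuous.continuousOn
  have hset : {x | levelMap q x ≤ c} = {x | q x ≤ q x₀} := by
    ext x
    exact ⟨fun h => hmax h, fun h => (levelMap_mono h).trans hx₀⟩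
  have hval : levelMap q x₀ = c :=
    le_antisymm hx₀ (hx₁ ▸ levelMap_mono (hmax (mem_ofPred.2 hx₁.le)))
  rw [hset, ← hval]
  simp [levelMap]

lemma measPres_levelMap {q : C(I, ℝ)}
    (hq : ∀ c, (volume : Measure I) {t | q t = c} = 0) :
    MeasPres ⟨levelMap q, continuous_levelMap hq⟩ := by
  have hm := (continuous_levelMap hq).measurable
  have : Measure.map (levelMap q) (volume : Measure I) = volume := by
    refine Measure.ext_of_Iic _ _ fun c => ?_
    rw [Measure.map_apply hm measurableSet_Iic, unitInterval.volume_Iic]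
    exact volume_levelMap_le hq c
  intro A hA
  rw [lebI_eq_volume]
  conv_rhs => rw [← this, Measure.map_apply hm hA]
  rfl

lemma dist_levelMap_le {f : C(I, I)} (hf : MeasPres f) {q : C(I, ℝ)} {δ : ℝ}
    (h : ∀ x, |q x - f x| ≤ δ) (x : I) : dist (levelMap q x) (f x) ≤ 2 * δ := by
  have key : ∀ c : I, (volume : Measure I).real {t | f t ≤ c} = c := by
    intro c
    have := hf (Iic c) measurableSet_Iic
    rw [lebI_eq_volume, unitInterval.volume_Iic] at this
    change (volume (f ⁻¹' Iic c)).toReal = c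
    rw [this, ENNReal.toReal_ofReal c.2.1]
  have hδ : 0 ≤ δ := (abs_nonneg _).trans (h x)
  have hx := abs_le.1 (h x)
  rw [Subtype.dist_eq, Real.dist_eq, abs_le]
  constructor
  · by_cases hc : (f x : ℝ) - 2 * δ < 0
    · have := (levelMap q x).2.1
      linarith
    · have h2 := (f x).2.2
      have := key ⟨f x - 2 * δ, by linarith, by linarith⟩
      have hsub : (volume : Measure I).real {t | f t ≤ ⟨f x - 2 * δ, by linarith, by linarith⟩} ≤
          levelMap q x := by
        refine measureReal_mono (μ := (volume : Measure I)) fun t ht => ?_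
        have h3 : (f t : ℝ) ≤ f x - 2 * δ := ht
        have := abs_le.1 (h t)
        simp only [mem_ofPred_eq]
        linarith
      rw [this] at hsub
      simp only at hsub
      linarith
  · by_cases hc : 1 < (f x : ℝ) + 2 * δ
    · have := (levelMap q x).2.2
      linarith
    · have h2 := (f x).2.1
      have := key ⟨f x + 2 * δ, by linarith, by linarith⟩
      have hsub : (levelMap q x : ℝ) ≤
          (volume : Measure I).real {t | f t ≤ ⟨f x + 2 * δ, by linarith, by linarith⟩} := by
        refine measureReal_mono (μ := (volume : Measure I)) fun t ht => ?_
        have h3 : q t ≤ q x := ht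
        have := abs_le.1 (h t)
        change (f t : ℝ) ≤ f x + 2 * δ
        linarith
      rw [this] at hsub
      simp only at hsub
      linarith

lemma dist_lt_dist_levelMap {q : C(I, ℝ)} {a b z : I} (hab : q a < q b)
    (hbetween : ∀ t ∈ uIoo a b, q t ∈ Ioo (q a) (q b))
    (hz : z ∉ uIcc a b) (hqz : q z ∈ Ioo (q a) (q b)) :
    dist a b < dist (levelMap q a) (levelMap q b) := by
  set V : Set I := (uIcc a b)ᶜ ∩ q ⁻¹' Ioo (q a) (q b) with hV
  have hVo : IsOpen V := isClosed_Icc.isOpen_compl.inter (isOpen_Ioo.preimage q.continuous)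
  have hVpos : 0 < (volume : Measure I) V :=
    volume_pos_of_mem_nhds_unitInterval (hVo.mem_nhds ⟨hz, hqz⟩)
  have hdisj : Disjoint (uIoo a b) V := by
    rw [Set.disjoint_left]
    intro t ht htV
    exact htV.1 (Ioo_subset_Icc_self ht)
  have hdisj2 : Disjoint {t | q t ≤ q a} (uIoo a b ∪ V) := by
    rw [Set.disjoint_left]
    rintro t ht (h | h)
    · exact absurd ht (not_le.2 (hbetween t h).1)
    · exact absurd ht (not_le.2 h.2.1)
  have hsub : {t | q t ≤ q a} ∪ (uIoo a b ∪ V) ⊆ {t | q t ≤ q b} := by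
    rintro t (h | h | h)
    · exact le_trans (mem_ofPred.1 h) hab.le
    · exact (hbetween t h).2.le
    · exact h.2.2.le
  have hle := measureReal_mono (μ := (volume : Measure I)) hsub
  rw [measureReal_union hdisj2 ((measurableSet_Ioo).union hVo.measurableSet),
    measureReal_union hdisj hVo.measurableSet] at hle
  have h1 : (volume : Measure I).real (uIoo a b) = dist b a := by
    simp [Measure.real, edist_dist]
  have h2 : 0 < (volume : Measure I).real V :=
    ENNReal.toReal_pos hVpos.ne' (measure_ne_top _ _)
  rw [h1] at hle
  have h3 : dist (levelMap q a) (levelMap q b) ≥ levelMap q b - levelMap q a := by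
    rw [dist_comm, Subtype.dist_eq, Real.dist_eq]
    exact le_abs_self _
  have h4 : ((levelMap q b : I) : ℝ) = (volume : Measure I).real {t | q t ≤ q b} := rfl
  have h5 : ((levelMap q a : I) : ℝ) = (volume : Measure I).real {t | q t ≤ q a} := rfl
  rw [dist_comm a b]
  linarith

lemma countable_fixSet_of_expanding {X ι : Type*} [MetricSpace X] [Countable ι] {g : X → X}
    {P : ι → Set X} (hcover : ∀ x, ∃ i, x ∈ P i)
    (hexp : ∀ i, ∀ x ∈ P i, ∀ y ∈ P i, x ≠ y → dist x y < dist (g x) (g y))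
    {k : ℕ} (hk : 1 ≤ k) : (FixSet g k).Countable := by
  choose c hc using hcover
  refine MapsTo.countable_of_injOn (f := fun x => fun i : Fin k => c (g^[i] x))
    (t := univ) (fun _ _ => mem_univ _) ?_ (to_countable _)
  intro x hx y hy hxy
  by_contra hne
  have key : ∀ j, j ≤ k → dist x y ≤ dist (g^[j] x) (g^[j] y) ∧
      (1 ≤ j → dist x y < dist (g^[j] x) (g^[j] y)) := by
    intro j
    induction j with
    | zero => simp
    | succ j ih =>
      intro hj
      have h1 := (ih (by omega)).1
      have hne' : g^[j] x ≠ g^[j] y := dist_pos.1 ((dist_pos.2 hne).trans_le h1)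
      have hcj : c (g^[j] x) = c (g^[j] y) := congrFun hxy ⟨j, by omega⟩
      have h2 := hexp _ _ (hc (g^[j] x)) _ (hcj ▸ hc (g^[j] y)) hne'
      rw [Function.iterate_succ_apply', Function.iterate_succ_apply']
      exact ⟨(h1.trans_lt h2).le, fun _ => h1.trans_lt h2⟩
  have := (key k le_rfl).2 hk
  rw [mem_ofPred.1 hx, mem_ofPred.1 hy] at this
  exact lt_irrefl _ this

/-- `S` has a countable open cover with diameters bounded by `2 ^ (-(n + i))`. -/
def HasGeometricCover (S : Set I) (n : ℕ) : Prop :=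
  ∃ U : ℕ → Set I, (∀ i, IsOpen (U i)) ∧ (∀ i, ediam (U i) ≤ (2⁻¹ : ENNReal) ^ (n + i)) ∧
    S ⊆ ⋃ i, U i

lemma dimH_eq_zero_of_hasGeometricCover {S : Set I} (h : ∀ n, HasGeometricCover S n) :
    dimH S = 0 := by
  choose U hU hdiam hcov using h
  have hlt : (2⁻¹ : ENNReal) < 1 := by simp
  have key : ∀ d : NNReal, 0 < d → μH[d] S = 0 := by
    intro d hd
    have hd' : (0 : ℝ) < d := hd
    set r : ENNReal := (2⁻¹ : ENNReal) ^ (d : ℝ) with hr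
    have hr1 : r < 1 := ENNReal.rpow_lt_one hlt hd'
    have hbound : ∀ n, ∑' i, ediam (U n i) ^ (d : ℝ) ≤ r ^ n * (1 - r)⁻¹ := by
      intro n
      rw [← ENNReal.tsum_geometric, ← ENNReal.tsum_mul_left]
      refine ENNReal.tsum_le_tsum fun i => ?_
      rw [← pow_add, hr, ← ENNReal.rpow_natCast, ← ENNReal.rpow_mul, mul_comm,
        ENNReal.rpow_mul, ENNReal.rpow_natCast]
      exact ENNReal.rpow_le_rpow (hdiam n i) hd'.le
    have hlim : Tendsto (fun n => r ^ n * (1 - r)⁻¹) atTop (𝓝 0) := by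
      have := ENNReal.Tendsto.mul_const (b := (1 - r)⁻¹)
        (ENNReal.tendsto_pow_atTop_nhds_zero_of_lt_one hr1)
        (Or.inr (ENNReal.inv_ne_top.2 (tsub_pos_of_lt hr1).ne'))
      simpa using this
    have h1 := Measure.hausdorffMeasure_le_liminf_tsum (d : ℝ) S (l := atTop)
      (fun n : ℕ => (2⁻¹ : ENNReal) ^ n) (ENNReal.tendsto_pow_atTop_nhds_zero_of_lt_one hlt) U
      (Eventually.of_forall fun n i => (hdiam n i).trans
        (pow_le_pow_right_of_le_one' hlt.le (Nat.le_add_right n i)))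
      (Eventually.of_forall hcov)
    have h2 := tendsto_of_tendsto_of_tendsto_of_le_of_le tendsto_const_nhds hlim
      (fun n => zero_le) hbound
    rw [h2.liminf_eq] at h1
    exact le_antisymm h1 (zero_le)
  refine le_antisymm (dimH_le fun d' hd' => ?_) (zero_le)
  by_contra hne
  have : 0 < d' := by
    rw [not_le] at hne
    exact_mod_cast hne
  rw [key d' this] at hd'
  exact ENNReal.zero_ne_top hd'

lemma Set.Countable.hasGeometricCover {S : Set I} (hS : S.Countable) (n : ℕ) :
    HasGeometricCover S n := by
  rcases S.eq_empty_or_nonempty with rfl | hne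
  · exact ⟨fun _ => ∅, by simp, by simp, by simp⟩
  obtain ⟨s, rfl⟩ := hS.exists_eq_range hne
  refine ⟨fun i => eball (s i) ((2⁻¹ : ENNReal) ^ (n + i + 1)), fun i => isOpen_eball,
    fun i => ?_, ?_⟩
  · refine ediam_eball_le.trans (le_of_eq ?_)
    rw [pow_succ, mul_comm, mul_assoc, ENNReal.inv_mul_cancel (by simp) (by simp), mul_one]
  · rintro _ ⟨i, rfl⟩
    refine mem_iUnion.2 ⟨i, mem_eball_self ?_⟩
    exact ENNReal.pow_pos (by simp) _

lemma isOpen_setOf_fixSet_subset {W : Set I} (hW : IsOpen W) (k : ℕ) :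
    IsOpen {f : C(I, I) | FixSet f k ⊆ W} := by
  have hiter : Continuous fun p : C(I, I) × I => p.1^[k] p.2 := by
    induction k with
    | zero => simpa using continuous_snd
    | succ k ih =>
      simp only [Function.iterate_succ_apply']
      exact continuous_eval.comp (continuous_fst.prodMk ih)
  rw [isOpen_iff_eventually]
  intro f hf
  have : ∀ᶠ g : C(I, I) in 𝓝 f, ∀ x ∈ Wᶜ, g^[k] x ≠ x := by
    refine hW.isClosed_compl.isCompact.eventually_forall_of_forall_eventually
      (P := fun (g : C(I, I)) x => g^[k] x ≠ x) fun x hx => ?_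
    have hne : f^[k] x ≠ x := fun h => hx (hf h)
    exact (isOpen_ne_fun hiter continuous_snd).mem_nhds hne
  filter_upwards [this] with g hg x hx
  by_contra hxW
  exact hg x hxW hx

lemma isOpen_setOf_hasGeometricCover (k n : ℕ) :
    IsOpen {f : C(I, I) | HasGeometricCover (FixSet f k) n} := by
  have : {f : C(I, I) | HasGeometricCover (FixSet f k) n} =
      ⋃ U ∈ {U : ℕ → Set I | (∀ i, IsOpen (U i)) ∧
        ∀ i, ediam (U i) ≤ (2⁻¹ : ENNReal) ^ (n + i)}, {f : C(I, I) | FixSet f k ⊆ ⋃ i, U i} := by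
    ext f
    simp [HasGeometricCover, and_assoc]
  rw [this]
  exact isOpen_biUnion fun U hU => isOpen_setOf_fixSet_subset (isOpen_iUnion hU.1) k

lemma exists_mem_Ioo_notMem_uIcc {q : C(I, ℝ)} {a b s t : I} (hab : q a < q b)
    (hle : a ≤ b) (hs : s ≤ a) (ht : b ≤ t) (hst : q t < q s) :
    ∃ z, z ∉ uIcc a b ∧ q z ∈ Ioo (q a) (q b) := by
  rw [uIcc_of_le hle]
  rcases lt_or_ge (q a) (q s) with h | h
  · obtain ⟨c, hc1, hc2⟩ := exists_between (lt_min hab h)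
    rw [lt_min_iff] at hc2
    obtain ⟨z, hz, rfl⟩ := intermediate_value_Icc' hs q.continuous.continuousOn ⟨hc1.le, hc2.2.le⟩
    refine ⟨z, fun hmem => ?_, hc1, hc2.1⟩
    have : z = a := le_antisymm hz.2 hmem.1
    exact hc1.ne (by rw [this])
  · obtain ⟨c, hc1, hc2⟩ := exists_between hab
    obtain ⟨z, hz, rfl⟩ := intermediate_value_Icc' ht q.continuous.continuousOn
      ⟨((hst.trans_le h).trans hc1).le, hc2.le⟩
    refine ⟨z, fun hmem => ?_, hc1, hc2⟩
    have : z = b := le_antisymm hmem.2 hz.1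
    exact hc2.ne (by rw [this])

lemma dist_lt_dist_levelMap_of_strictMonoOn {q : C(I, ℝ)} {a b s t : I} (hab : a < b)
    (hq : StrictMonoOn q (Icc a b)) (hs : s ≤ a) (ht : b ≤ t) (hst : q t < q s) :
    dist a b < dist (levelMap q a) (levelMap q b) := by
  have ha : a ∈ Icc a b := left_mem_Icc.2 hab.le
  have hb : b ∈ Icc a b := right_mem_Icc.2 hab.le
  obtain ⟨z, hz, hqz⟩ := exists_mem_Ioo_notMem_uIcc (hq ha hb hab) hab.le hs ht hst
  refine dist_lt_dist_levelMap (hq ha hb hab) (fun u hu => ?_) hz hqz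
  rw [uIoo_of_le hab.le] at hu
  exact ⟨hq ha (Ioo_subset_Icc_self hu) hu.1, hq (Ioo_subset_Icc_self hu) hb hu.2⟩

lemma dist_lt_dist_levelMap_of_strictAntiOn {q : C(I, ℝ)} {a b s t : I} (hab : a < b)
    (hq : StrictAntiOn q (Icc a b)) (hs : s ≤ a) (ht : b ≤ t) (hst : q s < q t) :
    dist a b < dist (levelMap q a) (levelMap q b) := by
  have ha : a ∈ Icc a b := left_mem_Icc.2 hab.le
  have hb : b ∈ Icc a b := right_mem_Icc.2 hab.le
  obtain ⟨z, hz, hqz⟩ := exists_mem_Ioo_notMem_uIcc (q := -q) (by simpa using hq ha hb hab)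
    hab.le hs ht (by simpa using hst)
  rw [dist_comm a b, dist_comm (levelMap q a)]
  refine dist_lt_dist_levelMap (z := z) (hq ha hb hab) (fun u hu => ?_) (by rwa [uIcc_comm]) ?_
  · rw [uIoo_comm, uIoo_of_le hab.le] at hu
    exact ⟨hq (Ioo_subset_Icc_self hu) hb hu.2, hq ha (Ioo_subset_Icc_self hu) hu.1⟩
  · simp only [ContinuousMap.neg_apply, mem_Ioo, neg_lt_neg_iff] at hqz
    exact ⟨hqz.2, hqz.1⟩

/-- The oscillation of frequency `N` used to make maps fold every short interval. -/
def wave (N : ℕ) (x : ℝ) : ℝ := Real.sin (2 * Real.pi * N * x)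

lemma continuous_wave (N : ℕ) : Continuous (wave N) := by
  unfold wave
  fun_prop

lemma abs_wave_le_one (N : ℕ) (x : ℝ) : |wave N x| ≤ 1 := Real.abs_sin_le_one _

lemma wave_add_div {N : ℕ} (hN : 0 < N) (k : ℕ) (r : ℝ) :
    wave N ((k + r) / N) = Real.sin (2 * Real.pi * r) := by
  have hN' : (N : ℝ) ≠ 0 := by positivity
  rw [wave, ← Real.sin_add_nat_mul_two_pi (2 * Real.pi * r) k]
  congr 1
  field_simp
  ring

lemma wave_div {N : ℕ} (hN : 0 < N) (k : ℕ) : wave N (k / N) = 0 := by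
  simpa using wave_add_div hN k 0

lemma wave_crest {N : ℕ} (hN : 0 < N) (k : ℕ) : wave N ((k + 1 / 4) / N) = 1 := by
  rw [wave_add_div hN, show 2 * Real.pi * (1 / 4) = Real.pi / 2 by ring, Real.sin_pi_div_two]

lemma wave_trough {N : ℕ} (hN : 0 < N) (k : ℕ) : wave N ((k + 3 / 4) / N) = -1 := by
  rw [wave_add_div hN, show 2 * Real.pi * (3 / 4) = Real.pi / 2 + Real.pi by ring,
    Real.sin_add_pi, Real.sin_pi_div_two]

lemma exists_wave_rise_fall {N : ℕ} (hN : 4 ≤ N) {x y : ℝ} (hx : 0 ≤ x) (hxy : x < y)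
    (hy : y ≤ 1) (hd : y - x ≤ 1 / N) :
    (∃ s t, 0 ≤ s ∧ s ≤ x ∧ y ≤ t ∧ t ≤ 1 ∧ t - s ≤ 5 / N ∧ wave N s + 1 ≤ wave N t) ∧
    (∃ s t, 0 ≤ s ∧ s ≤ x ∧ y ≤ t ∧ t ≤ 1 ∧ t - s ≤ 5 / N ∧ wave N t + 1 ≤ wave N s) := by
  have hN0 : 0 < N := by omega
  have hNr : (4 : ℝ) ≤ N := by exact_mod_cast hN
  have hNpos : (0 : ℝ) < N := by linarith
  rw [le_div_iff₀ hNpos] at hd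
  have hk1 : (⌊x * N⌋₊ : ℝ) ≤ x * N := Nat.floor_le (by positivity)
  have hk2 : x * N < ⌊x * N⌋₊ + 1 := Nat.lt_floor_add_one _
  set k := ⌊x * N⌋₊
  rcases le_or_gt y (1 / 2) with h | h
  · have hm1 : (⌊y * N⌋₊ : ℝ) ≤ y * N := Nat.floor_le (by nlinarith)
    have hm2 : y * N < ⌊y * N⌋₊ + 1 := Nat.lt_floor_add_one _
    set m := ⌊y * N⌋₊
    have hyN : y * N ≤ 1 / 2 * N := by gcongr
    have bounds : ∀ r : ℝ, 0 ≤ r → r ≤ 3 / 4 → y ≤ ((m + 1 : ℕ) + r) / N ∧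
        ((m + 1 : ℕ) + r) / N ≤ 1 ∧ ((m + 1 : ℕ) + r) / N - k / N ≤ 5 / N := by
      intro r h0 h1
      rw [le_div_iff₀ hNpos, div_le_one hNpos, ← sub_div, div_le_div_iff_of_pos_right hNpos]
      push_cast
      refine ⟨?_, ?_, ?_⟩ <;> linarith
    have hs : (k : ℝ) / N ≤ x := by rwa [div_le_iff₀ hNpos]
    obtain ⟨h1, h2, h3⟩ := bounds (1 / 4) (by norm_num) (by norm_num)
    obtain ⟨h4, h5, h6⟩ := bounds (3 / 4) (by norm_num) (by norm_num)
    refine ⟨⟨_, _, by positivity, hs, h1, h2, h3, ?_⟩, ⟨_, _, by positivity, hs, h4, h5, h6, ?_⟩⟩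
    · rw [wave_div hN0, wave_crest hN0]; norm_num
    · rw [wave_div hN0, wave_trough hN0]; norm_num
  · have hm1 : y * N ≤ ⌈y * N⌉₊ := Nat.le_ceil _
    have hm2 : (⌈y * N⌉₊ : ℝ) < y * N + 1 := Nat.ceil_lt_add_one (by nlinarith)
    have hm3 : (⌈y * N⌉₊ : ℝ) ≤ N := by
      exact_mod_cast Nat.ceil_le.2 (by nlinarith : y * N ≤ (N : ℝ))
    set m := ⌈y * N⌉₊
    have hyN : 1 / 2 * N < y * N := by gcongr
    have hkpos : 0 < k := by
      have : (0 : ℝ) < k := by linarith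
      exact_mod_cast this
    obtain ⟨j, hj⟩ : ∃ j, k = j + 1 := ⟨k - 1, by omega⟩
    rw [hj] at hk1 hk2
    push_cast at hk1 hk2
    have bounds : ∀ r : ℝ, 0 ≤ r → r ≤ 3 / 4 → ((j : ℝ) + r) / N ≤ x ∧
        m / N - ((j : ℝ) + r) / N ≤ 5 / N := by
      intro r h0 h1
      rw [div_le_iff₀ hNpos, ← sub_div, div_le_div_iff_of_pos_right hNpos]
      refine ⟨?_, ?_⟩ <;> linarith
    have ht1 : y ≤ m / N := by rwa [le_div_iff₀ hNpos]
    have ht2 : (m : ℝ) / N ≤ 1 := by rwa [div_le_one hNpos]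
    obtain ⟨h1, h2⟩ := bounds (1 / 4) (by norm_num) (by norm_num)
    obtain ⟨h4, h5⟩ := bounds (3 / 4) (by norm_num) (by norm_num)
    refine ⟨⟨_, _, by positivity, h4, ht1, ht2, h5, ?_⟩, ⟨_, _, by positivity, h1, ht1, ht2, h2, ?_⟩⟩
    · rw [wave_div hN0, wave_trough hN0]; norm_num
    · rw [wave_div hN0, wave_crest hN0]; norm_num

/-- Every interval `[a, b]` shorter than `η` is folded by `q`, in both directions. -/
def FoldsBelow (q : C(I, ℝ)) (η : ℝ) : Prop :=
  ∀ a b : I, a < b → (b : ℝ) - a ≤ η →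
    (∃ s t, s ≤ a ∧ b ≤ t ∧ q s < q t) ∧ (∃ s t, s ≤ a ∧ b ≤ t ∧ q t < q s)

lemma exists_polynomial_foldsBelow (f : C(I, I)) {δ : ℝ} (hδ : 0 < δ) :
    ∃ p : Polynomial ℝ, (∀ x : I, |p.eval (x : ℝ) - f x| ≤ 2 * δ) ∧
      ∃ η > 0, FoldsBelow (p.toContinuousMapOn I) η := by
  obtain ⟨η, hη, hunif⟩ := Metric.uniformContinuous_iff.1
    (CompactSpace.uniformContinuous_of_continuous f.continuous) (δ / 4) (by positivity)
  obtain ⟨M, hM⟩ := exists_nat_gt (5 / η)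
  set N := max M 4
  have hN : 4 ≤ N := le_max_right _ _
  have hNr : (4 : ℝ) ≤ N := by exact_mod_cast hN
  have hNpos : (0 : ℝ) < N := by linarith
  have hNη : 5 / (N : ℝ) < η := by
    have : (M : ℝ) ≤ N := by exact_mod_cast le_max_left M 4
    rw [div_lt_iff₀ hNpos]
    rw [div_lt_iff₀ hη] at hM
    nlinarith
  let F : C(I, ℝ) := ⟨fun x => f x + δ * wave N x, by
    have := continuous_wave N
    fun_prop⟩
  obtain ⟨p, hp⟩ := exists_polynomial_near_continuousMap 0 1 F (δ / 8) (by positivity)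
  have happrox : ∀ x : I, |p.eval (x : ℝ) - (f x + δ * wave N x)| < δ / 8 := fun x =>
    (ContinuousMap.norm_coe_le_norm (p.toContinuousMapOn I - F) x).trans_lt hp
  have hdrop : ∀ u v : I, |(u : ℝ) - v| ≤ 5 / N → wave N u + 1 ≤ wave N v →
      p.eval (u : ℝ) < p.eval (v : ℝ) := by
    intro u v huv hw
    have h1 : |(f u : ℝ) - f v| < δ / 4 := hunif (a := u) (b := v) (huv.trans_lt hNη)
    have h2 := abs_lt.1 h1
    have h3 := abs_lt.1 (happrox u)
    have h4 := abs_lt.1 (happrox v)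
    have h5 := mul_le_mul_of_nonneg_left hw hδ.le
    linarith
  refine ⟨p, fun x => ?_, 1 / N, by positivity, fun a b hab hlen => ?_⟩
  · have h1 := abs_lt.1 (happrox x)
    have h2 := abs_le.1 (abs_wave_le_one N x)
    rw [abs_le]
    constructor <;> nlinarith
  · obtain ⟨⟨s, t, hs0, hs, ht, ht1, hst, hw⟩, ⟨s', t', hs0', hs', ht', ht1', hst', hw'⟩⟩ :=
      exists_wave_rise_fall hN a.2.1 hab b.2.2 hlen
    have hab' : (a : ℝ) < b := hab
    refine ⟨⟨⟨s, hs0, by linarith⟩, ⟨t, by linarith, ht1⟩, hs, ht, hdrop _ _ ?_ hw⟩,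
      ⟨⟨s', hs0', by linarith⟩, ⟨t', by linarith, ht1'⟩, hs', ht', hdrop _ _ ?_ hw'⟩⟩
    · rw [abs_sub_comm, abs_of_nonneg (by simp only; linarith)]; exact hst
    · rw [abs_of_nonneg (by simp only; linarith)]; exact hst'

lemma derivative_ne_zero_of_foldsBelow {p : Polynomial ℝ} {η : ℝ} (hη : 0 < η)
    (hp : FoldsBelow (p.toContinuousMapOn I) η) : p.derivative ≠ 0 := by
  intro h
  rw [Polynomial.eq_C_of_derivative_eq_zero h] at hp
  have hmin : 0 < min η 1 := lt_min hη one_pos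
  obtain ⟨⟨s, t, -, -, hlt⟩, -⟩ := hp 0 ⟨min η 1, hmin.le, min_le_right _ _⟩ hmin (by simp)
  simp at hlt

lemma volume_level_polynomial_eq_zero {p : Polynomial ℝ} (hp : p.derivative ≠ 0) (c : ℝ) :
    (volume : Measure I) {t | p.toContinuousMapOn I t = c} = 0 := by
  have hne : p - Polynomial.C c ≠ 0 := by
    intro h
    rw [sub_eq_zero.1 h] at hp
    simp at hp
  have hfin := (Polynomial.finite_setOfPred_isRoot hne).preimage
    (Subtype.val_injective (p := (· ∈ I))).injOn
  refine (hfin.subset fun t ht => ?_).measure_zero _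
  have : p.eval (t : ℝ) = c := ht
  simp [this]

lemma exists_ball_expanding {p : Polynomial ℝ} {η : ℝ} (hη : 0 < η)
    (hp : FoldsBelow (p.toContinuousMapOn I) η) {x : I} (hx : p.derivative.eval (x : ℝ) ≠ 0) :
    ∃ r > 0, ∀ a ∈ ball x r, ∀ b ∈ ball x r, a ≠ b →
      dist a b < dist (levelMap (p.toContinuousMapOn I) a) (levelMap (p.toContinuousMapOn I) b) := by
  have hsign : ∃ r > 0, (∀ u ∈ ball (x : ℝ) r, 0 < p.derivative.eval u) ∨
      (∀ u ∈ ball (x : ℝ) r, p.derivative.eval u < 0) := by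
    have hcont := p.derivative.continuous.continuousAt (x := (x : ℝ))
    rcases lt_or_gt_of_ne hx with h | h
    · obtain ⟨r, hr, hsub⟩ := Metric.eventually_nhds_iff_ball.1 (hcont.eventually_lt_const h)
      exact ⟨r, hr, Or.inr hsub⟩
    · obtain ⟨r, hr, hsub⟩ := Metric.eventually_nhds_iff_ball.1 (hcont.eventually_const_lt h)
      exact ⟨r, hr, Or.inl hsub⟩
  obtain ⟨r, hr, hsign⟩ := hsign
  have key : ∀ a ∈ ball x (min r (η / 2)), ∀ b ∈ ball x (min r (η / 2)), a < b →
      dist a b < dist (levelMap (p.toContinuousMapOn I) a)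
        (levelMap (p.toContinuousMapOn I) b) := by
    intro a ha b hb hab
    rw [mem_ball, lt_min_iff] at ha hb
    have hlen : (b : ℝ) - a ≤ η := by
      have h1 := (le_abs_self ((b : ℝ) - a)).trans (dist_triangle_right b a x)
      linarith
    have hsub : Icc (a : ℝ) b ⊆ ball (x : ℝ) r :=
      (convex_ball (x : ℝ) r).ordConnected.out ha.1 hb.1
    obtain ⟨⟨s, t, hs, ht, hst⟩, ⟨s', t', hs', ht', hst'⟩⟩ := hp a b hab hlen
    rcases hsign with hpos | hneg
    · refine dist_lt_dist_levelMap_of_strictMonoOn hab ?_ hs' ht' hst'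
      have := strictMonoOn_of_deriv_pos (convex_Icc (a : ℝ) b) p.continuous.continuousOn
        fun u hu => by rw [Polynomial.deriv]; exact hpos u (hsub (interior_subset hu))
      exact fun u hu v hv huv => this hu hv huv
    · refine dist_lt_dist_levelMap_of_strictAntiOn hab ?_ hs ht hst
      have := strictAntiOn_of_deriv_neg (convex_Icc (a : ℝ) b) p.continuous.continuousOn
        fun u hu => by rw [Polynomial.deriv]; exact hneg u (hsub (interior_subset hu))
      exact fun u hu v hv huv => this hu hv huv
  refine ⟨min r (η / 2), by positivity, fun a ha b hb hne => ?_⟩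
  rcases lt_or_gt_of_ne hne with h | h
  · exact key a ha b hb h
  · rw [dist_comm a, dist_comm (levelMap _ a)]
    exact key b hb a ha h

lemma countable_fixSet_levelMap {p : Polynomial ℝ} {η : ℝ} (hη : 0 < η)
    (hp : FoldsBelow (p.toContinuousMapOn I) η) {k : ℕ} (hk : 1 ≤ k) :
    (FixSet (levelMap (p.toContinuousMapOn I)) k).Countable := by
  set Z : Set I := {x | p.derivative.eval (x : ℝ) = 0} with hZ
  have hZc : Z.Countable := ((Polynomial.finite_setOfPred_isRoot
    (derivative_ne_zero_of_foldsBelow hη hp)).preimage Subtype.val_injective.injOn).countable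
  have hball : ∀ x : I, ∃ r : ℝ, x ∈ Zᶜ → 0 < r ∧ ∀ a ∈ ball x r, ∀ b ∈ ball x r, a ≠ b →
      dist a b < dist (levelMap (p.toContinuousMapOn I) a)
        (levelMap (p.toContinuousMapOn I) b) := by
    intro x
    by_cases hx : x ∈ Zᶜ
    · obtain ⟨r, hr, h⟩ := exists_ball_expanding hη hp hx
      exact ⟨r, fun _ => ⟨hr, h⟩⟩
    · exact ⟨0, fun h => absurd h hx⟩
  choose r hr using hball
  obtain ⟨T, hTZ, hTc, hT⟩ := TopologicalSpace.countable_cover_nhdsWithin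
    (f := fun x => ball x (r x)) (s := Zᶜ)
    fun x hx => mem_nhdsWithin_of_mem_nhds (ball_mem_nhds x (hr x hx).1)
  have := hZc.to_subtype
  have := hTc.to_subtype
  refine countable_fixSet_of_expanding (ι := Z ⊕ T)
    (P := Sum.elim (fun z => {(z : I)}) fun x => ball (x : I) (r x)) (fun x => ?_) ?_ hk
  · by_cases hx : x ∈ Z
    · exact ⟨Sum.inl ⟨x, hx⟩, rfl⟩
    · obtain ⟨y, hy, hxy⟩ := mem_iUnion₂.1 (hT hx)
      exact ⟨Sum.inr ⟨y, hy⟩, hxy⟩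
  · rintro (z | y) a ha b hb hne
    · exact absurd ((mem_singleton_iff.1 ha).trans (mem_singleton_iff.1 hb).symm) hne
    · exact (hr y (hTZ y.2)).2 a ha b hb hne

lemma exists_measPres_near_countable_fixSet {f : C(I, I)} (hf : MeasPres f) {ε : ℝ}
    (hε : 0 < ε) :
    ∃ g : C(I, I), MeasPres g ∧ dist f g < ε ∧ ∀ k, 1 ≤ k → (FixSet g k).Countable := by
  obtain ⟨p, hpf, η, hη, hfold⟩ := exists_polynomial_foldsBelow f (δ := ε / 5) (by positivity)
  have hnull := volume_level_polynomial_eq_zero (derivative_ne_zero_of_foldsBelow hη hfold)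
  refine ⟨⟨_, continuous_levelMap hnull⟩, measPres_levelMap hnull, ?_,
    fun k hk => countable_fixSet_levelMap hη hfold hk⟩
  refine lt_of_le_of_lt ((ContinuousMap.dist_le (C := 4 * (ε / 5)) (by positivity)).2
    fun x => ?_) (by linarith)
  rw [dist_comm]
  refine (dist_levelMap_le hf hpf x).trans (le_of_eq ?_)
  ring

lemma dense_setOf_hasGeometricCover {k : ℕ} (hk : 1 ≤ k) (n : ℕ) :
    Dense {f : CLam | HasGeometricCover (FixSet f.1 k) n} := by
  refine Metric.dense_iff.2 fun f ε hε => ?_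
  obtain ⟨g, hg, hfg, hfix⟩ := exists_measPres_near_countable_fixSet f.2 hε
  exact ⟨⟨g, hg⟩, by rwa [mem_ball, dist_comm], (hfix k hk).hasGeometricCover n⟩

theorem generic_Fix_dimH_zero :
    ∃ R : Set ↥CLam, R ∈ residual ↥CLam ∧
      ∀ f ∈ R, ∀ k : ℕ, 1 ≤ k →
        dimH (FixSet (⇑f.1) k) = 0 ∧ dimH (PerSet (⇑f.1) k) = 0 := by
  refine ⟨⋂ (k : ℕ) (n : ℕ), {f | HasGeometricCover (FixSet f.1 (k + 1)) n}, ?_, ?_⟩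
  · refine countable_iInter_mem.2 fun k => countable_iInter_mem.2 fun n => ?_
    exact residual_of_dense_open
      ((isOpen_setOf_hasGeometricCover (k + 1) n).preimage continuous_subtype_val)
      (dense_setOf_hasGeometricCover (by omega) n)
  · intro f hf k hk
    obtain ⟨j, rfl⟩ : ∃ j, k = j + 1 := ⟨k - 1, by omega⟩
    have hfix : dimH (FixSet (⇑f.1) (j + 1)) = 0 :=
      dimH_eq_zero_of_hasGeometricCover (mem_iInter.1 (mem_iInter.1 hf j))
    exact ⟨hfix, le_antisymm ((dimH_mono fun x hx => hx.1).trans hfix.le) zero_le⟩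
end
end

section
/- For a generic map f in C_λ(I) (i.e., for every f in some residual subset of C_λ(I)), the Hausdorff dimension of the set Per(f) = ⋃_{k≥1} {x ∈ [0,1] : f^k(x) = x} of all periodic points of f is zero. -/
open MeasureTheory Set Metric Filter Topology

noncomputable section

/-- `S` is covered by finitely many sets on each of which `φ` expands distances by a factor at
least `K`. -/
def PiecewiseExpandingOn {α β : Type*} [PseudoMetricSpace α] [PseudoMetricSpace β]
    (K : ℝ) (φ : α → β) (S : Set α) : Prop :=
  ∃ 𝒞 : Set (Set α), 𝒞.Finite ∧ S ⊆ ⋃₀ 𝒞 ∧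
    ∀ C ∈ 𝒞, ∀ x ∈ C, ∀ y ∈ C, K * dist x y ≤ dist (φ x) (φ y)

namespace PiecewiseExpandingOn

variable {α β γ : Type*} [PseudoMetricSpace α] [PseudoMetricSpace β] [PseudoMetricSpace γ]

theorem singleton (K : ℝ) (φ : α → β) (a : α) : PiecewiseExpandingOn K φ {a} :=
  ⟨{{a}}, finite_singleton _, by simp, by simp⟩

theorem union {K : ℝ} {φ : α → β} {S T : Set α} (hS : PiecewiseExpandingOn K φ S)
    (hT : PiecewiseExpandingOn K φ T) : PiecewiseExpandingOn K φ (S ∪ T) := by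
  obtain ⟨𝒞, hf, hc, he⟩ := hS
  obtain ⟨𝒟, hf', hc', he'⟩ := hT
  refine ⟨𝒞 ∪ 𝒟, hf.union hf', ?_, ?_⟩
  · rw [sUnion_union]
    exact union_subset_union hc hc'
  · rintro C (hC | hC)
    exacts [he C hC, he' C hC]

theorem mono {K : ℝ} {φ : α → β} {S T : Set α} (hT : PiecewiseExpandingOn K φ T) (hST : S ⊆ T) :
    PiecewiseExpandingOn K φ S :=
  let ⟨𝒞, hf, hc, he⟩ := hT
  ⟨𝒞, hf, hST.trans hc, he⟩

theorem of_le {K : ℝ} {φ : α → β} {ψ : α → γ} {S : Set α} (h : PiecewiseExpandingOn K φ S)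
    {L : ℝ} (hle : ∀ x ∈ S, ∀ y ∈ S, K * dist x y ≤ dist (φ x) (φ y) →
      L * dist x y ≤ dist (ψ x) (ψ y)) :
    PiecewiseExpandingOn L ψ S := by
  obtain ⟨𝒞, hf, hc, he⟩ := h
  refine ⟨(fun C => C ∩ S) '' 𝒞, hf.image _, ?_, ?_⟩
  · intro x hx
    obtain ⟨C, hC, hxC⟩ := hc hx
    exact ⟨_, mem_image_of_mem _ hC, hxC, hx⟩
  · rintro _ ⟨C, hC, rfl⟩ x ⟨hx, hxS⟩ y ⟨hy, hyS⟩
    exact hle x hxS y hyS (he C hC x hx y hy)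

theorem congr {K : ℝ} {φ ψ : α → β} {S : Set α} (h : PiecewiseExpandingOn K φ S)
    (hEq : EqOn φ ψ S) : PiecewiseExpandingOn K ψ S :=
  h.of_le fun x hx y hy hxy => by rwa [← hEq hx, ← hEq hy]

theorem comp {K L : ℝ} (hL : 0 ≤ L) {φ : α → β} {ψ : β → γ} {S : Set α} {T : Set β}
    (hψ : PiecewiseExpandingOn L ψ T) (hφ : PiecewiseExpandingOn K φ S) (hST : MapsTo φ S T) :
    PiecewiseExpandingOn (L * K) (ψ ∘ φ) S := by
  obtain ⟨𝒞, hf, hc, he⟩ := hφ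
  obtain ⟨𝒟, hf', hc', he'⟩ := hψ
  refine ⟨image2 (fun C D => C ∩ φ ⁻¹' D) 𝒞 𝒟, hf.image2 _ hf', ?_, ?_⟩
  · intro x hx
    obtain ⟨C, hC, hxC⟩ := hc hx
    obtain ⟨D, hD, hxD⟩ := hc' (hST hx)
    exact ⟨_, mem_image2_of_mem hC hD, hxC, hxD⟩
  · rintro _ ⟨C, hC, D, hD, rfl⟩ x ⟨hx, hx'⟩ y ⟨hy, hy'⟩
    calc L * K * dist x y = L * (K * dist x y) := by ring
      _ ≤ L * dist (φ x) (φ y) := mul_le_mul_of_nonneg_left (he C hC x hx y hy) hL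
      _ ≤ _ := he' D hD _ hx' _ hy'

theorem iterate {K : ℝ} (hK : 0 ≤ K) {φ : α → α} (h : PiecewiseExpandingOn K φ univ) (k : ℕ) :
    PiecewiseExpandingOn (K ^ k) φ^[k] univ := by
  induction k with
  | zero => exact ⟨{univ}, finite_singleton _, by simp, by simp⟩
  | succ k ih =>
    rw [Function.iterate_succ', pow_succ']
    exact h.comp hK ih (mapsTo_univ _ _)

theorem finite_fixedPoints {X : Type*} [MetricSpace X] {K : ℝ} (hK : 1 < K) {φ : X → X}
    (h : PiecewiseExpandingOn K φ univ) : {x | φ x = x}.Finite := by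
  obtain ⟨𝒞, hf, hc, he⟩ := h
  have hsub : {x | φ x = x} ⊆ ⋃ C ∈ 𝒞, C ∩ {x | φ x = x} := fun x hx => by
    obtain ⟨C, hC, hxC⟩ := hc (mem_univ x)
    exact mem_biUnion hC ⟨hxC, hx⟩
  refine (hf.biUnion fun C hC => Set.Subsingleton.finite ?_).subset hsub
  rintro x ⟨hx, hfx⟩ y ⟨hy, hfy⟩
  have := he C hC x hx y hy
  rw [mem_ofPred_eq] at hfx hfy
  rw [hfx, hfy] at this
  exact dist_le_zero.1 (by nlinarith [dist_nonneg (x := x) (y := y)])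

end PiecewiseExpandingOn

/-- Lebesgue measure restricted to `[0,1]`. -/
abbrev volI : Measure ℝ := volume.restrict (Icc 0 1)

/-- The map that is the identity up to `q` and a tent of slopes `±2` and height `1` on `[q, 1]`. -/
def foldMap (q x : ℝ) : ℝ := min (max x (2 * x - q)) (2 + q - 2 * x)

theorem continuous_foldMap (q : ℝ) : Continuous (foldMap q) := by
  unfold foldMap
  fun_prop

theorem foldMap_of_le {q x : ℝ} (hq : q ≤ 1) (hx : x ≤ q) : foldMap q x = x := by
  rw [foldMap, max_eq_left (by linarith), min_eq_left (by linarith)]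

theorem foldMap_of_mem {q x : ℝ} (hx : q ≤ x) (hx' : x ≤ (1 + q) / 2) :
    foldMap q x = 2 * x - q := by
  rw [foldMap, max_eq_right (by linarith), min_eq_left (by linarith)]

theorem foldMap_of_ge {q x : ℝ} (hq : q ≤ 1) (hx : (1 + q) / 2 ≤ x) :
    foldMap q x = 2 + q - 2 * x := by
  rw [foldMap, max_eq_right (by linarith), min_eq_right (by linarith)]

theorem foldMap_expanding {q : ℝ} (hq : q ≤ 1) : PiecewiseExpandingOn 1 (foldMap q) univ := by
  refine ⟨{Iic q, Icc q ((1 + q) / 2), Ici ((1 + q) / 2)}, by simp, ?_, ?_⟩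
  · intro x _
    rcases le_total x q with h | h
    · exact ⟨Iic q, by simp, h⟩
    rcases le_total x ((1 + q) / 2) with h' | h'
    · exact ⟨Icc q ((1 + q) / 2), by simp, h, h'⟩
    · exact ⟨Ici ((1 + q) / 2), by simp, h'⟩
  · rintro C (rfl | rfl | rfl) x hx y hy <;> rw [Real.dist_eq, Real.dist_eq, one_mul]
    · rw [foldMap_of_le hq hx, foldMap_of_le hq hy]
    · rw [foldMap_of_mem hx.1 hx.2, foldMap_of_mem hy.1 hy.2]
      rw [show 2 * x - q - (2 * y - q) = 2 * (x - y) by ring, abs_mul, abs_two]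
      linarith [abs_nonneg (x - y)]
    · rw [foldMap_of_ge hq hx, foldMap_of_ge hq hy]
      rw [show 2 + q - 2 * x - (2 + q - 2 * y) = 2 * (y - x) by ring, abs_mul, abs_two,
        abs_sub_comm]
      linarith [abs_nonneg (y - x)]

theorem foldMap_zero_expanding : PiecewiseExpandingOn 2 (foldMap 0) (Icc 0 1) := by
  refine ⟨{Icc 0 ((1 + 0) / 2), Ici ((1 + 0) / 2)}, by simp, ?_, ?_⟩
  · rintro x ⟨hx, -⟩
    rcases le_total x ((1 + 0) / 2) with h' | h'
    · exact ⟨Icc 0 ((1 + 0) / 2), by simp, hx, h'⟩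
    · exact ⟨Ici ((1 + 0) / 2), by simp, h'⟩
  · rintro C (rfl | rfl) x hx y hy <;> rw [Real.dist_eq, Real.dist_eq]
    · rw [foldMap_of_mem hx.1 hx.2, foldMap_of_mem hy.1 hy.2,
        show 2 * x - 0 - (2 * y - 0) = 2 * (x - y) by ring, abs_mul, abs_two]
    · rw [foldMap_of_ge zero_le_one hx, foldMap_of_ge zero_le_one hy,
        show 2 + 0 - 2 * x - (2 + 0 - 2 * y) = 2 * (y - x) by ring, abs_mul, abs_two,
        abs_sub_comm]

theorem volI_Ici (y : ℝ) : volI (Ici y) = ENNReal.ofReal (1 - max y 0) := by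
  rw [Measure.restrict_apply measurableSet_Ici, ← Real.volume_Icc]
  congr 1
  ext x
  simp only [mem_inter_iff, mem_Ici, mem_Icc, max_le_iff]
  tauto

theorem measurePreserving_foldMap {q : ℝ} (hq : q ∈ Icc (0 : ℝ) 1) :
    MeasurePreserving (foldMap q) volI volI := by
  have hm := (continuous_foldMap q).measurable
  refine ⟨hm, ?_⟩
  have : IsFiniteMeasure (Measure.map (foldMap q) volI) := Measure.isFiniteMeasure_map _ _
  refine Measure.ext_of_Ici _ _ fun y => ?_
  obtain ⟨h0, h1⟩ := hq
  rw [Measure.map_apply hm measurableSet_Ici, volI_Ici,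
    Measure.restrict_apply (hm measurableSet_Ici)]
  rcases le_or_gt y q with h | h
  · rw [← Real.volume_Icc]
    congr 1
    ext x
    simp only [mem_inter_iff, mem_preimage, mem_Ici, mem_Icc, foldMap, le_min_iff, le_max_iff,
      max_le_iff]
    constructor
    · rintro ⟨⟨h2 | h2, h3⟩, h4, h5⟩
      · exact ⟨⟨h2, h4⟩, h5⟩
      · exact ⟨⟨by linarith, h4⟩, h5⟩
    · rintro ⟨⟨h2, h3⟩, h4⟩
      exact ⟨⟨Or.inl h2, by linarith⟩, h3, h4⟩
  · rw [max_eq_left (by linarith),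
      show 1 - y = (1 + (q - y) / 2) - (y + q) / 2 by ring, ← Real.volume_Icc]
    congr 1
    ext x
    simp only [mem_inter_iff, mem_preimage, mem_Ici, mem_Icc, foldMap, le_min_iff, le_max_iff]
    constructor
    · rintro ⟨⟨h2 | h2, h3⟩, h4, h5⟩ <;> constructor <;> linarith
    · rintro ⟨h2, h3⟩
      exact ⟨⟨Or.inr (by linarith), by linarith⟩, by linarith, by linarith⟩

theorem measurePreserving_one_sub : MeasurePreserving (fun x : ℝ => 1 - x) volI volI := by
  have := (Measure.measurePreserving_sub_left (volume : Measure ℝ) 1).restrict_preimage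
    (measurableSet_Icc (a := (0 : ℝ)) (b := 1))
  simpa [preimage_const_sub_Icc] using this

theorem one_sub_expanding : PiecewiseExpandingOn 1 (fun x : ℝ => 1 - x) univ :=
  ⟨{univ}, finite_singleton _, by simp, fun C _ x _ y _ => by
    rw [one_mul, Real.dist_eq, Real.dist_eq, show 1 - x - (1 - y) = y - x by ring, abs_sub_comm]⟩

theorem exists_measurePreserving_expanding {p q : ℝ} (hp : p ∈ Icc (0 : ℝ) 1)
    (hq : q ∈ Icc (0 : ℝ) 1) :
    ∃ G : ℝ → ℝ, Continuous G ∧ MeasurePreserving G volI volI ∧ G 0 = p ∧ G 1 = q ∧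
      MapsTo G (Icc 0 1) (Icc 0 1) ∧ PiecewiseExpandingOn 2 G (Icc 0 1) := by
  obtain ⟨hp0, hp1⟩ := hp
  obtain ⟨hq0, hq1⟩ := hq
  let R : ℝ → ℝ := fun x => 1 - x
  have hR : Continuous R := by fun_prop
  have hmaps : ∀ r ∈ Icc (0 : ℝ) 1, MapsTo (foldMap r) (Icc 0 1) (Icc 0 1) := by
    rintro r ⟨hr0, hr1⟩ x ⟨hx0, hx1⟩
    rcases le_total x r with h | h
    · rw [foldMap_of_le hr1 h]; exact ⟨hx0, hx1⟩
    rcases le_total x ((1 + r) / 2) with h' | h'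
    · rw [foldMap_of_mem h h']; constructor <;> linarith
    · rw [foldMap_of_ge hr1 h']; constructor <;> linarith
  have hRmaps : MapsTo R (Icc 0 1) (Icc 0 1) := by
    rintro x ⟨hx0, hx1⟩
    exact ⟨by simp only [R]; linarith, by simp only [R]; linarith⟩
  have ha : 1 - p / 2 ∈ Icc (0 : ℝ) 1 := ⟨by linarith, by linarith⟩
  have hb : 1 - q / 2 ∈ Icc (0 : ℝ) 1 := ⟨by linarith, by linarith⟩
  have hz : (0 : ℝ) ∈ Icc (0 : ℝ) 1 := ⟨le_rfl, zero_le_one⟩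
  have hin := hRmaps.comp ((hmaps _ ha).comp (hRmaps.comp (hmaps _ hb)))
  refine ⟨foldMap 0 ∘ R ∘ foldMap (1 - p / 2) ∘ R ∘ foldMap (1 - q / 2), ?_, ?_, ?_, ?_, ?_, ?_⟩
  · exact (continuous_foldMap _).comp (hR.comp ((continuous_foldMap _).comp
      (hR.comp (continuous_foldMap _))))
  · exact (measurePreserving_foldMap hz).comp (measurePreserving_one_sub.comp
      ((measurePreserving_foldMap ha).comp (measurePreserving_one_sub.comp
        (measurePreserving_foldMap hb))))
  · simp only [Function.comp, R]
    rw [foldMap_of_le hb.2 hb.1, foldMap_of_ge ha.2 (by linarith),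
      foldMap_of_mem (by linarith) (by linarith)]
    ring
  · simp only [Function.comp, R]
    rw [foldMap_of_ge hb.2 (by linarith), foldMap_of_le ha.2 (by linarith),
      foldMap_of_ge (by linarith) (by linarith)]
    ring
  · exact (hmaps _ hz).comp hin
  · have := foldMap_zero_expanding.comp zero_le_two ((one_sub_expanding.comp zero_le_one
      ((foldMap_expanding ha.2).comp zero_le_one (one_sub_expanding.comp zero_le_one
        (foldMap_expanding hb.2) (mapsTo_univ _ _)) (mapsTo_univ _ _)) (mapsTo_univ _ _)).mono
      (subset_univ _)) hin
    simpa using this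

theorem exists_continuous_inverse {F : ℝ → ℝ} {a b : ℝ} (hab : a ≤ b)
    (hF : ContinuousOn F (Icc a b)) (hmono : StrictMonoOn F (Icc a b)) :
    ∃ Q : ℝ → ℝ, Continuous Q ∧ (∀ t ∈ Icc (F a) (F b), Q t ∈ Icc a b ∧ F (Q t) = t) ∧
      ∀ y ∈ Icc a b, Q (F y) = y := by
  have hle : F a ≤ F b := hmono.monotoneOn (left_mem_Icc.2 hab) (right_mem_Icc.2 hab) hab
  have himage : F '' Icc a b = Icc (F a) (F b) := by
    refine Subset.antisymm ?_ (intermediate_value_Icc hab hF)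
    rintro _ ⟨y, hy, rfl⟩
    exact ⟨hmono.monotoneOn (left_mem_Icc.2 hab) hy hy.1,
      hmono.monotoneOn hy (right_mem_Icc.2 hab) hy.2⟩
  let e : Icc a b ≃o Icc (F a) (F b) :=
    (hmono.orderIso F _).trans (OrderIso.setCongr _ _ himage)
  have he : ∀ y, (e y : ℝ) = F y := fun y => rfl
  have hQ : ∀ t (ht : t ∈ Icc (F a) (F b)), e.symm (projIcc (F a) (F b) hle t) = e.symm ⟨t, ht⟩ :=
    fun t ht => by rw [projIcc_of_mem hle ht]
  refine ⟨fun t => e.symm (projIcc (F a) (F b) hle t),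
    continuous_subtype_val.comp (e.symm.continuous.comp continuous_projIcc), fun t ht => ?_,
    fun y hy => ?_⟩
  · refine ⟨Subtype.coe_prop _, ?_⟩
    simp only
    rw [hQ t ht, ← he, e.apply_symm_apply]
  · have hy' : F y ∈ Icc (F a) (F b) := (e ⟨y, hy⟩).2
    simp only
    rw [hQ _ hy', show (⟨F y, hy'⟩ : Icc (F a) (F b)) = e ⟨y, hy⟩ from rfl, e.symm_apply_apply]

theorem volume_Icc_inter_preimage_affine {c d : ℝ} (hcd : c < d) (T : Set ℝ) :
    volume (Icc c d ∩ (fun x => (x - c) / (d - c)) ⁻¹' T) =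
      ENNReal.ofReal (d - c) * volume (Icc 0 1 ∩ T) := by
  have hl : 0 < d - c := sub_pos.2 hcd
  have hset : Icc c d ∩ (fun x => (x - c) / (d - c)) ⁻¹' T =
      (fun x => x + -c) ⁻¹' ((fun x => (d - c)⁻¹ * x) ⁻¹' (Icc 0 1 ∩ T)) := by
    ext x
    have : (x - c) / (d - c) = (d - c)⁻¹ * (x + -c) := by rw [div_eq_inv_mul, sub_eq_add_neg x c]
    simp only [mem_inter_iff, mem_preimage, ← this, mem_Icc]
    rw [le_div_iff₀ hl, zero_mul, div_le_one hl]
    simp only [sub_nonneg, sub_le_sub_iff_right]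
  rw [hset, measure_preimage_add_right, Real.volume_preimage_mul_left (inv_ne_zero hl.ne'),
    inv_inv, abs_of_pos hl]

/-- The normalised distribution function of `f` on `[c, d]`. -/
def cdfOn (f : ℝ → ℝ) (c d y : ℝ) : ℝ := volume.real (Icc c d ∩ f ⁻¹' Iic y) / (d - c)

section cdfOn

variable {f : ℝ → ℝ} {c d : ℝ}

theorem volume_Icc_inter_ne_top (S : Set ℝ) : volume (Icc c d ∩ S) ≠ ⊤ :=
  ((measure_mono inter_subset_left).trans_lt (by simp)).ne

theorem ofReal_mul_cdfOn (hcd : c < d) (y : ℝ) :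
    ENNReal.ofReal (d - c) * ENNReal.ofReal (cdfOn f c d y) = volume (Icc c d ∩ f ⁻¹' Iic y) := by
  rw [← ENNReal.ofReal_mul (sub_pos.2 hcd).le, cdfOn, mul_div_cancel₀ _ (sub_pos.2 hcd).ne',
    measureReal_def, ENNReal.ofReal_toReal (volume_Icc_inter_ne_top _)]

theorem cdfOn_sub (hf : Continuous f) {u v : ℝ} (huv : u ≤ v) :
    cdfOn f c d v - cdfOn f c d u = volume.real (Icc c d ∩ f ⁻¹' Ioc u v) / (d - c) := by
  rw [cdfOn, cdfOn, ← sub_div]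
  congr 1
  have hm : MeasurableSet (Icc c d ∩ f ⁻¹' Ioc u v) :=
    measurableSet_Icc.inter (hf.measurable measurableSet_Ioc)
  have hun : Icc c d ∩ f ⁻¹' Iic v = (Icc c d ∩ f ⁻¹' Iic u) ∪ (Icc c d ∩ f ⁻¹' Ioc u v) := by
    rw [← inter_union_distrib_left, ← preimage_union, Iic_union_Ioc_eq_Iic huv]
  rw [hun, measureReal_union _ hm (volume_Icc_inter_ne_top _) (volume_Icc_inter_ne_top _)]
  · ring
  · refine Disjoint.mono inter_subset_right inter_subset_right (Disjoint.preimage f ?_)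
    exact Set.disjoint_left.2 fun x hx hx' => not_lt.2 hx hx'.1

theorem cdfOn_mono (hcd : c < d) (hf : Continuous f) : Monotone (cdfOn f c d) := fun u v huv => by
  rw [← sub_nonneg, cdfOn_sub hf huv]
  exact div_nonneg measureReal_nonneg (sub_pos.2 hcd).le

theorem cdfOn_strictMonoOn (hcd : c < d) (hf : Continuous f) {a b : ℝ}
    (himage : f '' Icc c d = Icc a b) : StrictMonoOn (cdfOn f c d) (Icc a b) := by
  intro u hu v hv huv
  rw [← sub_pos, cdfOn_sub hf huv.le]
  refine div_pos ?_ (sub_pos.2 hcd)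
  have hopen : IsOpen (Ioo c d ∩ f ⁻¹' Ioo u v) := isOpen_Ioo.inter (isOpen_Ioo.preimage hf)
  obtain ⟨w, huw, hwv⟩ := exists_between huv
  obtain ⟨x, hx, rfl⟩ : w ∈ f '' Icc c d := himage ▸ ⟨hu.1.trans huw.le, hwv.le.trans hv.2⟩
  rw [← closure_Ioo hcd.ne] at hx
  have hne : (Ioo c d ∩ f ⁻¹' Ioo u v).Nonempty := by
    rw [inter_comm]
    exact mem_closure_iff.1 hx _ (isOpen_Ioo.preimage hf) ⟨huw, hwv⟩
  refine (ENNReal.toReal_pos (hopen.measure_pos _ hne).ne' ?_).trans_le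
    (measureReal_mono (inter_subset_inter Ioo_subset_Icc_self
      (preimage_mono Ioo_subset_Ioc_self)) (volume_Icc_inter_ne_top _))
  exact ((measure_mono inter_subset_left).trans_lt (by simp)).ne

theorem volume_Icc_inter_preimage_le (hf : MeasurePreserving f volI volI) (hc : 0 ≤ c)
    (hd : d ≤ 1) {S : Set ℝ} (hS : MeasurableSet S) : volume (Icc c d ∩ f ⁻¹' S) ≤ volume S :=
  calc volume (Icc c d ∩ f ⁻¹' S) ≤ volume (f ⁻¹' S ∩ Icc 0 1) := by
        rw [inter_comm]
        exact measure_mono (inter_subset_inter_right _ (Icc_subset_Icc hc hd))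
    _ = volI (f ⁻¹' S) := (Measure.restrict_apply (hf.measurable hS)).symm
    _ = volI S := hf.measure_preimage hS.nullMeasurableSet
    _ ≤ volume S := Measure.restrict_apply_le _ _

theorem abs_cdfOn_sub_le (hcd : c < d) (hc : 0 ≤ c) (hd : d ≤ 1) (hf : Continuous f)
    (hp : MeasurePreserving f volI volI) (u v : ℝ) :
    |cdfOn f c d u - cdfOn f c d v| ≤ |u - v| / (d - c) := by
  wlog huv : u ≤ v generalizing u v
  · rw [abs_sub_comm, abs_sub_comm u]
    exact this v u (le_of_not_ge huv)
  rw [abs_sub_comm, abs_sub_comm u, abs_of_nonneg (sub_nonneg.2 (cdfOn_mono hcd hf huv)),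
    abs_of_nonneg (sub_nonneg.2 huv), cdfOn_sub hf huv]
  refine div_le_div_of_nonneg_right ?_ (sub_pos.2 hcd).le
  refine ENNReal.toReal_le_of_le_ofReal (sub_nonneg.2 huv) ?_
  rw [← Real.volume_Ioc]
  exact volume_Icc_inter_preimage_le hp hc hd measurableSet_Ioc

theorem cdfOn_eq_zero (hc : 0 ≤ c) (hd : d ≤ 1) {a b : ℝ}
    (hp : MeasurePreserving f volI volI) (himage : f '' Icc c d = Icc a b) :
    cdfOn f c d a = 0 := by
  have hsub : Icc c d ∩ f ⁻¹' Iic a ⊆ Icc c d ∩ f ⁻¹' {a} := by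
    rintro x ⟨hx, hxa⟩
    exact ⟨hx, le_antisymm hxa (himage ▸ mem_image_of_mem f hx : f x ∈ Icc a b).1⟩
  have : volume (Icc c d ∩ f ⁻¹' Iic a) = 0 := by
    refine measure_mono_null hsub (nonpos_iff_eq_zero.1 ?_)
    simpa using volume_Icc_inter_preimage_le hp hc hd (measurableSet_singleton a)
  rw [cdfOn, measureReal_def, this]
  simp

theorem cdfOn_eq_one (hcd : c < d) {a b : ℝ} (himage : f '' Icc c d = Icc a b) :
    cdfOn f c d b = 1 := by
  have : Icc c d ∩ f ⁻¹' Iic b = Icc c d :=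
    inter_eq_left.2 fun x hx => (himage ▸ mem_image_of_mem f hx : f x ∈ Icc a b).2
  rw [cdfOn, this, Real.volume_real_Icc_of_le hcd.le, div_self (sub_pos.2 hcd).ne']

end cdfOn

theorem exists_expanding_replacement {f : ℝ → ℝ} {c d : ℝ} (hcd : c < d) (hc : 0 ≤ c) (hd : d ≤ 1)
    (hf : Continuous f) (hp : MeasurePreserving f volI volI) :
    ∃ g : ℝ → ℝ, Continuous g ∧ MeasurePreserving g volI volI ∧ (∀ x ∉ Ioo c d, g x = f x) ∧
      (∀ x ∈ Icc c d, g x ∈ f '' Icc c d) ∧ PiecewiseExpandingOn 2 g (Icc c d) := by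
  have hl : 0 < d - c := sub_pos.2 hcd
  obtain ⟨a, b, himage⟩ : ∃ a b, f '' Icc c d = Icc a b :=
    ⟨_, _, ContinuousOn.image_Icc hcd.le hf.continuousOn⟩
  have hmem : ∀ x ∈ Icc c d, f x ∈ Icc a b := fun x hx => himage ▸ mem_image_of_mem f hx
  have hcm := hmem c (left_mem_Icc.2 hcd.le)
  have hdm := hmem d (right_mem_Icc.2 hcd.le)
  have hab : a ≤ b := hcm.1.trans hcm.2
  set F := cdfOn f c d with hF
  have hmono := cdfOn_strictMonoOn hcd hf himage
  have hFa : F a = 0 := cdfOn_eq_zero hc hd hp himage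
  have hFb : F b = 1 := cdfOn_eq_one hcd himage
  have hFlip := abs_cdfOn_sub_le hcd hc hd hf hp
  have hFc : Continuous F := by
    refine LipschitzWith.continuous (K := Real.toNNReal (d - c)⁻¹)
      (LipschitzWith.of_dist_le_mul fun u v => ?_)
    rw [Real.coe_toNNReal _ (inv_pos.2 hl).le, Real.dist_eq, Real.dist_eq, ← div_eq_inv_mul]
    exact hFlip u v
  have hF01 : ∀ y ∈ Icc a b, F y ∈ Icc (0 : ℝ) 1 := fun y hy =>
    ⟨hFa ▸ cdfOn_mono hcd hf hy.1, hFb ▸ cdfOn_mono hcd hf hy.2⟩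
  obtain ⟨Q, hQc, hQ, hQF⟩ := exists_continuous_inverse hab hFc.continuousOn hmono
  rw [hFa, hFb] at hQ
  obtain ⟨G, hGc, hGp, hG0, hG1, hGm, hGe⟩ :=
    exists_measurePreserving_expanding (hF01 _ hcm) (hF01 _ hdm)
  let A : ℝ → ℝ := fun x => (x - c) / (d - c)
  have hAm : MapsTo A (Icc c d) (Icc 0 1) := fun x hx =>
    ⟨div_nonneg (sub_nonneg.2 hx.1) hl.le, (div_le_one hl).2 (by linarith [hx.2])⟩
  have hAc : A c = 0 := by simp [A]
  have hAd : A d = 1 := div_self hl.ne'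
  let g : ℝ → ℝ := fun x => if x ≤ c then f x else if x ≤ d then Q (G (A x)) else f x
  have hAcont : Continuous A := by fun_prop
  have hgc : Continuous g := by
    refine Continuous.if_le hf (Continuous.if_le (hQc.comp (hGc.comp hAcont)) hf continuous_id
      continuous_const ?_) continuous_id continuous_const ?_
    · rintro x rfl
      rw [hAd, hG1, hQF _ hdm]
    · rintro x rfl
      rw [if_pos hcd.le]
      rw [hAc, hG0, hQF _ hcm]
  have hgin : ∀ x ∈ Icc c d, g x = Q (G (A x)) := by
    rintro x ⟨hx1, hx2⟩
    rcases hx1.eq_or_lt with rfl | hx1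
    · simp only [g, if_pos le_rfl]
      rw [hAc, hG0, hQF _ hcm]
    · simp only [g, if_neg (not_le.2 hx1), if_pos hx2]
  have hgout : ∀ x ∉ Ioo c d, g x = f x := by
    intro x hx
    rcases le_or_gt x c with h | h
    · simp only [g, if_pos h]
    rcases (not_lt.1 fun h' => hx ⟨h, h'⟩ : d ≤ x).eq_or_lt with rfl | h'
    · rw [hgin _ (right_mem_Icc.2 hcd.le), hAd, hG1, hQF _ hdm]
    · simp only [g, if_neg (not_le.2 h), if_neg (not_le.2 h')]
  have hgmem : ∀ x ∈ Icc c d, g x ∈ Icc a b := fun x hx => by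
    rw [hgin x hx]
    exact (hQ _ (hGm (hAm hx))).1
  have hFg : ∀ x ∈ Icc c d, F (g x) = G (A x) := fun x hx => by
    rw [hgin x hx]
    exact (hQ _ (hGm (hAm hx))).2
  have hlocal : Measure.map g (volume.restrict (Icc c d)) =
      Measure.map f (volume.restrict (Icc c d)) := by
    have := Measure.isFiniteMeasure_map (volume.restrict (Icc c d)) g
    refine Measure.ext_of_Iic _ _ fun y => ?_
    rw [Measure.map_apply hgc.measurable measurableSet_Iic,
      Measure.map_apply hf.measurable measurableSet_Iic,
      Measure.restrict_apply (hgc.measurable measurableSet_Iic),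
      Measure.restrict_apply (hf.measurable measurableSet_Iic)]
    rcases lt_or_ge y a with hy | hy
    · rw [show g ⁻¹' Iic y ∩ Icc c d = ∅ from eq_empty_of_forall_notMem fun x hx =>
        (hy.trans_le (hgmem x hx.2).1).not_ge hx.1,
        show f ⁻¹' Iic y ∩ Icc c d = ∅ from eq_empty_of_forall_notMem fun x hx =>
        (hy.trans_le (hmem x hx.2).1).not_ge hx.1]
    rcases le_or_gt b y with hy' | hy'
    · have hgy : Icc c d ⊆ g ⁻¹' Iic y := fun x hx => (hgmem x hx).2.trans hy'
      have hfy : Icc c d ⊆ f ⁻¹' Iic y := fun x hx => (hmem x hx).2.trans hy'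
      rw [inter_eq_right.2 hgy, inter_eq_right.2 hfy]
    have hyab : y ∈ Icc a b := ⟨hy, hy'.le⟩
    have hset : g ⁻¹' Iic y ∩ Icc c d = Icc c d ∩ A ⁻¹' (G ⁻¹' Iic (F y)) := by
      ext x
      simp only [mem_inter_iff, mem_preimage, mem_Iic]
      rw [and_comm]
      refine and_congr_right fun hx => ?_
      rw [← hFg x hx]
      exact (hmono.le_iff_le (hgmem x hx) hyab).symm
    rw [hset, volume_Icc_inter_preimage_affine hcd, inter_comm (Icc 0 1),
      ← Measure.restrict_apply (hGc.measurable measurableSet_Iic),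
      hGp.measure_preimage measurableSet_Iic.nullMeasurableSet,
      Measure.restrict_apply measurableSet_Iic, inter_comm (f ⁻¹' _), ← ofReal_mul_cdfOn hcd,
      inter_comm, ← hF]
    congr 1
    rw [← sub_zero (F y), ← Real.volume_Icc]
    congr 1
    ext x
    have := (hF01 y hyab).2
    simp only [mem_inter_iff, mem_Icc, mem_Iic, sub_zero]
    exact ⟨fun h => ⟨h.1.1, h.2⟩, fun h => ⟨⟨h.1, h.2.trans this⟩, h.2⟩⟩
  refine ⟨g, hgc, ⟨hgc.measurable, ?_⟩, hgout, fun x hx => himage ▸ hgmem x hx, ?_⟩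
  · have hsplit : volI = volume.restrict (Icc c d) + volume.restrict (Icc 0 1 \ Icc c d) := by
      rw [volI, ← Measure.restrict_inter_add_sdiff (Icc 0 1) (measurableSet_Icc (a := c) (b := d)),
        inter_eq_right.2 (Icc_subset_Icc hc hd)]
    have hout : Measure.map g (volume.restrict (Icc 0 1 \ Icc c d)) =
        Measure.map f (volume.restrict (Icc 0 1 \ Icc c d)) := by
      refine Measure.map_congr ?_
      filter_upwards [ae_restrict_mem (measurableSet_Icc.diff measurableSet_Icc)] with x hx
      exact hgout x fun h => hx.2 (Ioo_subset_Icc_self h)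
    refine Eq.trans ?_ hp.map_eq
    rw [hsplit, Measure.map_add _ _ hgc.measurable, Measure.map_add _ _ hf.measurable, hlocal, hout]
  · have hA : PiecewiseExpandingOn (d - c)⁻¹ A (Icc c d) :=
      ⟨{univ}, finite_singleton _, by simp, fun _ _ x _ y _ => le_of_eq (by
        rw [Real.dist_eq, Real.dist_eq, div_sub_div_same, sub_sub_sub_cancel_right, abs_div,
          abs_of_pos hl, div_eq_inv_mul])⟩
    refine (hGe.comp zero_le_two hA hAm).of_le fun x hx y hy hxy => ?_
    rw [Function.comp, Function.comp, ← hFg x hx, ← hFg y hy] at hxy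
    have h1 := hxy.trans (hFlip _ _)
    rw [div_eq_inv_mul, mul_comm (2 : ℝ), mul_assoc] at h1
    exact le_of_mul_le_mul_left h1 (inv_pos.2 hl)

theorem exists_expanding_approx {f : ℝ → ℝ} (hf : Continuous f)
    (hp : MeasurePreserving f volI volI) (hm : MapsTo f (Icc 0 1) (Icc 0 1)) {ε : ℝ} (hε : 0 < ε) :
    ∃ g : ℝ → ℝ, Continuous g ∧ MeasurePreserving g volI volI ∧ MapsTo g (Icc 0 1) (Icc 0 1) ∧
      (∀ x ∈ Icc (0 : ℝ) 1, |g x - f x| ≤ ε) ∧ PiecewiseExpandingOn 2 g (Icc 0 1) := by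
  obtain ⟨δ, hδ, hfδ⟩ := Metric.uniformContinuousOn_iff.1
    (isCompact_Icc.uniformContinuousOn_of_continuous (hf.continuousOn (s := Icc 0 1))) ε hε
  obtain ⟨N, hN⟩ := exists_nat_one_div_lt hδ
  have hN0 : (0 : ℝ) < N + 1 := by positivity
  suffices H : ∀ n : ℕ, n ≤ N + 1 → ∃ g : ℝ → ℝ, Continuous g ∧ MeasurePreserving g volI volI ∧
      MapsTo g (Icc 0 1) (Icc 0 1) ∧ (∀ x, n / (N + 1 : ℝ) ≤ x → g x = f x) ∧
      (∀ x ∈ Icc (0 : ℝ) 1, |g x - f x| ≤ ε) ∧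
      PiecewiseExpandingOn 2 g (Icc 0 (n / (N + 1 : ℝ))) by
    obtain ⟨g, h1, h2, h3, -, h5, h6⟩ := H (N + 1) le_rfl
    rw [Nat.cast_add_one, div_self hN0.ne'] at h6
    exact ⟨g, h1, h2, h3, h5, h6⟩
  intro n
  induction n with
  | zero =>
    intro _
    refine ⟨f, hf, hp, hm, fun _ _ => rfl, fun x _ => by simpa using hε.le, ?_⟩
    simpa using PiecewiseExpandingOn.singleton 2 f 0
  | succ n ih =>
    intro hn
    obtain ⟨g, hg, hgp, hgm, hgf, hgε, hge⟩ := ih (by omega)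
    set c : ℝ := n / (N + 1 : ℝ) with hc
    set d : ℝ := (n + 1 : ℕ) / (N + 1 : ℝ) with hd
    have hdc : d = c + 1 / (N + 1 : ℝ) := by rw [hc, hd, ← add_div, Nat.cast_add_one]
    have hcd : c < d := by rw [hdc]; exact lt_add_of_pos_right _ (by positivity)
    have hc0 : 0 ≤ c := by positivity
    have hd1 : d ≤ 1 := by
      rw [hd, div_le_one hN0]
      exact_mod_cast hn
    have hgfd : ∀ x ∈ Icc c d, g x = f x := fun x hx => hgf x hx.1
    obtain ⟨g', hg', hgp', hout, hin, hge'⟩ := exists_expanding_replacement hcd hc0 hd1 hg hgp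
    have hsub : Icc c d ⊆ Icc 0 1 := Icc_subset_Icc hc0 hd1
    refine ⟨g', hg', hgp', fun x hx => ?_, fun x hx => ?_, fun x hx => ?_, ?_⟩
    · by_cases hxd : x ∈ Icc c d
      · obtain ⟨y, hy, hyx⟩ := hin x hxd
        exact hyx ▸ hgm (hsub hy)
      · rw [hout x fun h => hxd (Ioo_subset_Icc_self h)]
        exact hgm hx
    · rw [hout x fun h => h.2.not_ge hx, hgf x (hcd.le.trans hx)]
    · by_cases hxd : x ∈ Icc c d
      · obtain ⟨y, hy, hyx⟩ := hin x hxd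
        rw [← hyx, hgfd y hy, ← Real.dist_eq]
        refine (hfδ y (hsub hy) x hx ((Real.dist_le_of_mem_Icc hy hxd).trans_lt ?_)).le
        rwa [hdc, add_sub_cancel_left]
      · rw [hout x fun h => hxd (Ioo_subset_Icc_self h)]
        exact hgε x hx
    · rw [← Icc_union_Icc_eq_Icc hc0 hcd.le]
      exact (hge.congr fun x hx => (hout x fun h => h.1.not_ge hx.2).symm).union hge'

theorem measurePreserving_coe_unitInterval :
    MeasurePreserving (Subtype.val : unitInterval → ℝ) lebI volI :=
  measurePreserving_subtype_coe measurableSet_Icc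

theorem exists_measPres_expanding_approx {f : C(unitInterval, unitInterval)} (hf : MeasPres f)
    {ε : ℝ} (hε : 0 < ε) :
    ∃ g : C(unitInterval, unitInterval), MeasPres g ∧ dist g f < ε ∧
      PiecewiseExpandingOn 2 g univ := by
  let F : ℝ → ℝ := fun x => f (projIcc 0 1 zero_le_one x)
  have hFc : Continuous F :=
    continuous_subtype_val.comp (f.continuous.comp continuous_projIcc)
  have hFf : ∀ x : unitInterval, F x = f x := fun x => by simp only [F, projIcc_val]
  have hFp : MeasurePreserving F volI volI := by
    refine ⟨hFc.measurable, ?_⟩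
    have hcomp : F ∘ Subtype.val = Subtype.val ∘ f := funext hFf
    rw [← measurePreserving_coe_unitInterval.map_eq,
      Measure.map_map hFc.measurable measurable_subtype_coe, hcomp,
      ← Measure.map_map measurable_subtype_coe f.continuous.measurable,
      hf.measurePreserving.map_eq]
  obtain ⟨G, hGc, hGp, hGm, hGF, hGe⟩ := exists_expanding_approx hFc hFp
    (fun x _ => (f (projIcc 0 1 zero_le_one x)).2) (half_pos hε)
  let g : C(unitInterval, unitInterval) :=
    ⟨hGm.restrict G _ _, hGc.continuousOn.mapsToRestrict hGm⟩
  have hgG : ∀ x, (g x : ℝ) = G x := fun x => rfl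
  refine ⟨g, fun A hA => ?_, ?_, ?_⟩
  · have hS : MeasurableSet (Subtype.val '' A) := measurableSet_Icc.subtype_image hA
    have hA' : A = Subtype.val ⁻¹' (Subtype.val '' A) :=
      (preimage_image_eq A Subtype.val_injective).symm
    have hv := measurePreserving_coe_unitInterval
    conv_rhs => rw [hA', hv.measure_preimage hS.nullMeasurableSet,
      ← hGp.measure_preimage hS.nullMeasurableSet,
      ← hv.measure_preimage (hGc.measurable hS).nullMeasurableSet]
    conv_lhs => rw [hA']
    rfl
  · rw [ContinuousMap.dist_lt_iff hε]
    intro x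
    rw [Subtype.dist_eq, hgG, ← hFf, Real.dist_eq]
    exact (hGF x x.2).trans_lt (half_lt_self hε)
  · have hval : PiecewiseExpandingOn 1 (Subtype.val : unitInterval → ℝ) univ :=
      ⟨{univ}, finite_singleton _, by simp, by simp [Subtype.dist_eq]⟩
    refine (hGe.comp zero_le_two hval fun x _ => x.2).of_le fun x _ y _ hxy => ?_
    rwa [mul_one] at hxy

/-- The maps whose `k`-periodic points have a cover by finitely many balls of a common radius
less than `1 / (n + 1)`, with small `1 / (n + 1)`-dimensional content. -/
def smallFixSet (k n : ℕ) : Set CLam :=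
  {f | ∃ (P : Finset unitInterval) (δ : ℝ), 0 < δ ∧ δ < 1 / (n + 1) ∧
    P.card * δ ^ (1 / (n + 1 : ℝ)) < 1 / (n + 1) ∧ FixSet f.1 k ⊆ ⋃ p ∈ P, ball p δ}

theorem isOpen_smallFixSet (k n : ℕ) : IsOpen (smallFixSet k n) := by
  have hcont : Continuous fun p : CLam × unitInterval => (⇑p.1.1)^[k] p.2 := by
    induction k with
    | zero => exact continuous_snd
    | succ k ih =>
      simp only [Function.iterate_succ_apply']
      exact (continuous_subtype_val.comp continuous_fst).eval ih
  have hopen : ∀ V : Set unitInterval, IsOpen V → IsOpen {f : CLam | FixSet f.1 k ⊆ V} := by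
    intro V hV
    have hclosed : IsClosed {p : CLam × unitInterval | p.2 ∈ Vᶜ ∧ (⇑p.1.1)^[k] p.2 = p.2} :=
      (hV.isClosed_compl.preimage continuous_snd).inter (isClosed_eq hcont continuous_snd)
    convert (isClosedMap_fst_of_compactSpace _ hclosed).isOpen_compl using 1
    ext f
    simp only [mem_ofPred_eq, mem_compl_iff, mem_image, Prod.exists, exists_and_right,
      exists_eq_right, not_exists, not_and, FixSet, subset_def]
    exact forall_congr' fun x => ⟨fun h h1 h2 => h1 (h h2), fun h h1 => not_not.1 fun h2 => h h2 h1⟩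
  have : smallFixSet k n = ⋃ (P : Finset unitInterval) (δ : ℝ) (_ : 0 < δ ∧ δ < 1 / (n + 1 : ℝ) ∧
      P.card * δ ^ (1 / (n + 1 : ℝ)) < 1 / (n + 1)),
      {f : CLam | FixSet f.1 k ⊆ ⋃ p ∈ P, ball p δ} := by
    ext f
    simp only [smallFixSet, mem_ofPred_eq, mem_iUnion, exists_prop, and_assoc]
  rw [this]
  exact isOpen_iUnion fun P => isOpen_iUnion fun δ => isOpen_iUnion fun _ =>
    hopen _ (isOpen_biUnion fun p _ => isOpen_ball)

theorem mem_smallFixSet_of_finite {f : CLam} {k : ℕ} (hf : (FixSet f.1 k).Finite) (n : ℕ) :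
    f ∈ smallFixSet k n := by
  have hn : (0 : ℝ) < 1 / (n + 1) := by positivity
  have hlim : Tendsto (fun δ : ℝ => (hf.toFinset.card : ℝ) * δ ^ (1 / (n + 1 : ℝ))) (𝓝[>] 0)
      (𝓝 0) := by
    have : Continuous fun δ : ℝ => (hf.toFinset.card : ℝ) * δ ^ (1 / (n + 1 : ℝ)) :=
      continuous_const.mul (Real.continuous_rpow_const hn.le)
    have h0 := this.tendsto 0
    rw [Real.zero_rpow hn.ne', mul_zero] at h0
    exact h0.mono_left nhdsWithin_le_nhds
  obtain ⟨δ, hδ, hδ0, hδn⟩ :=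
    ((hlim.eventually_lt_const hn).and (Ioo_mem_nhdsGT hn)).exists
  refine ⟨hf.toFinset, δ, hδ0, hδn, hδ, fun x hx => ?_⟩
  exact mem_biUnion (hf.mem_toFinset.2 hx) (mem_ball_self hδ0)

theorem dense_smallFixSet (k n : ℕ) : Dense (smallFixSet (k + 1) n) := by
  rw [Metric.dense_iff]
  intro f ε hε
  obtain ⟨g, hg, hgf, hge⟩ := exists_measPres_expanding_approx f.2 hε
  refine ⟨⟨g, hg⟩, hgf, mem_smallFixSet_of_finite ?_ n⟩
  exact (hge.iterate zero_le_two (k + 1)).finite_fixedPoints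
    (one_lt_pow₀ one_lt_two k.succ_ne_zero)

theorem dimH_eq_zero_of_mem_smallFixSet {f : CLam} {k : ℕ} (hf : ∀ n, f ∈ smallFixSet k n) :
    dimH (FixSet f.1 k) = 0 := by
  choose P δ hδ0 hδn hδP hcov using hf
  have hlim : Tendsto (fun n : ℕ => 1 / (n + 1 : ℝ)) atTop (𝓝 0) :=
    tendsto_one_div_add_atTop_nhds_zero_nat
  have key : ∀ s : NNReal, 0 < s → μH[s] (FixSet f.1 k) = 0 := by
    intro s hs
    have hs' : (0 : ℝ) < s := hs
    let t : ∀ n, P n → Set unitInterval := fun n p => ball p (δ n)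
    have hdiam : ∀ n i, ediam (t n i) ≤ ENNReal.ofReal (2 * δ n) := fun n i => by
      rw [ENNReal.ofReal_mul zero_le_two, ENNReal.ofReal_ofNat]
      simp only [t, ← Metric.eball_ofReal]
      exact Metric.ediam_eball_le
    have hsum : ∀ᶠ n in atTop, ∑ i, ediam (t n i) ^ (s : ℝ) ≤
        ENNReal.ofReal (2 ^ (s : ℝ) * (1 / (n + 1 : ℝ))) := by
      filter_upwards [hlim.eventually_lt_const hs'] with n hn
      have hδ1 : δ n ≤ 1 := (hδn n).le.trans (by
        rw [div_le_one (by positivity)]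
        linarith [n.cast_nonneg (α := ℝ)])
      calc ∑ i, ediam (t n i) ^ (s : ℝ)
          ≤ ∑ _i : P n, ENNReal.ofReal ((2 * δ n) ^ (s : ℝ)) := by
            refine Finset.sum_le_sum fun i _ => ?_
            rw [← ENNReal.ofReal_rpow_of_nonneg (by linarith [hδ0 n]) hs'.le]
            exact ENNReal.rpow_le_rpow (hdiam n i) hs'.le
        _ = ENNReal.ofReal ((P n).card * (2 * δ n) ^ (s : ℝ)) := by
            rw [Finset.sum_const, Finset.card_univ, Fintype.card_coe, nsmul_eq_mul,
              ENNReal.ofReal_mul (Nat.cast_nonneg _), ENNReal.ofReal_natCast]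
        _ ≤ _ := by
            refine ENNReal.ofReal_le_ofReal ?_
            rw [Real.mul_rpow zero_le_two (hδ0 n).le, mul_left_comm]
            refine mul_le_mul_of_nonneg_left ?_ (by positivity)
            refine le_trans ?_ (hδP n).le
            exact mul_le_mul_of_nonneg_left
              (Real.rpow_le_rpow_of_exponent_ge (hδ0 n) hδ1 hn.le) (Nat.cast_nonneg _)
    have hr : Tendsto (fun n => ENNReal.ofReal (2 * δ n)) atTop (𝓝 0) := by
      have h0 : Tendsto δ atTop (𝓝 0) :=
        squeeze_zero (fun n => (hδ0 n).le) (fun n => (hδn n).le) hlim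
      simpa using ENNReal.tendsto_ofReal (h0.const_mul 2)
    have hb : Tendsto (fun n : ℕ => ENNReal.ofReal (2 ^ (s : ℝ) * (1 / (n + 1 : ℝ)))) atTop
        (𝓝 0) := by
      simpa using ENNReal.tendsto_ofReal (hlim.const_mul (2 ^ (s : ℝ)))
    have hsub : ∀ n, FixSet f.1 k ⊆ ⋃ i, t n i := fun n x hx => by
      obtain ⟨p, hp, hxp⟩ := mem_iUnion₂.1 (hcov n hx)
      exact mem_iUnion.2 ⟨⟨p, hp⟩, hxp⟩
    refine nonpos_iff_eq_zero.1 ((Measure.hausdorffMeasure_le_liminf_sum _ _ _ hr t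
      (Eventually.of_forall hdiam) (Eventually.of_forall hsub)).trans ?_)
    rw [← hb.liminf_eq]
    exact liminf_le_liminf hsum
  refine nonpos_iff_eq_zero.1 (dimH_le fun s hs => ?_)
  by_contra hpos
  rw [key s (by simpa [pos_iff_ne_zero] using hpos)] at hs
  exact ENNReal.zero_ne_top hs

theorem generic_Per_dimH_zero :
    ∃ R : Set ↥CLam, R ∈ residual ↥CLam ∧
      ∀ f ∈ R, dimH (PerAll (⇑f.1)) = 0 := by
  refine ⟨⋂ (k : ℕ) (n : ℕ), smallFixSet (k + 1) n, ?_, fun f hf => ?_⟩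
  · exact countable_iInter_mem.2 fun k => countable_iInter_mem.2 fun n =>
      residual_of_dense_open (isOpen_smallFixSet _ _) (dense_smallFixSet k n)
  · rw [PerAll, dimH_bUnion (Set.to_countable _)]
    simp only [ENNReal.iSup_eq_zero]
    intro k hk
    obtain ⟨k, rfl⟩ := Nat.exists_eq_add_of_le' (show 1 ≤ k from hk)
    exact dimH_eq_zero_of_mem_smallFixSet fun n => mem_iInter₂.1 hf k n
end
end
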